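/- arXiv:1110.3361 — 3 statements merged into one kernel-verified Lean document; each statement's English description precedes it below -/
import Mathlib

section
/- There exists an absolute constant α > 0 such that the following holds. Set λ_n = e^{−1} + α·(log n)^{−2} and ℓ_n = ⌈(log n)^3/α⌉. Then P( there exist an integer ℓ' with ℓ_n ≤ ℓ' < 2ℓ_n and a path γ ∈ Γ_{ℓ'} with X(γ) ≤ λ_n·ℓ' and M(γ) ≤ 3·log n ) → 0 as n → ∞. -/
open MeasureTheory ProbabilityTheory Filter Finset

namespace Paper

/-- A path of length `ℓ` in the complete graph on `Fin n`: a sequence of `ℓ+1` distinct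
vertices. -/
abbrev Path (n ℓ : ℕ) := {v : Fin (ℓ + 1) → Fin n // Function.Injective v}

/-- The `i`-th edge of a path. -/
def Path.edge {n ℓ : ℕ} (γ : Path n ℓ) (i : Fin ℓ) : Sym2 (Fin n) :=
  s(γ.1 i.castSucc, γ.1 i.succ)

/-- The total weight `X(γ)` of a path. -/
noncomputable def weight {n ℓ : ℕ} (ω : Sym2 (Fin n) → ℝ) (γ : Path n ℓ) : ℝ :=
  ∑ i : Fin ℓ, ω (γ.edge i)

/-- Partial sum of the first `k` edge weights of a path. -/
noncomputable def partialSum {n ℓ : ℕ} (ω : Sym2 (Fin n) → ℝ) (γ : Path n ℓ) (k : ℕ) : ℝ :=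
  ∑ i : Fin ℓ, if (i : ℕ) < k then ω (γ.edge i) else 0

/-- The deviation `M(γ) = max_{1 ≤ k ≤ ℓ} |∑_{i=1}^k X_{e_i} - (k/ℓ) X(γ)|`. -/
noncomputable def deviation {n ℓ : ℕ} (ω : Sym2 (Fin n) → ℝ) (γ : Path n ℓ) : ℝ :=
  ⨆ k : Fin ℓ, |partialSum ω γ ((k : ℕ) + 1) - (((k : ℕ) + 1 : ℝ) / ℓ) * weight ω γ|

/-- The law of the i.i.d. edge weights: each edge carries an exponential variable with
mean `n` (rate `1/n`). -/
noncomputable def P (n : ℕ) : Measure (Sym2 (Fin n) → ℝ) :=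
  Measure.pi fun _ => expMeasure ((n : ℝ)⁻¹)

/-- `L n λ ω` : the maximal `ℓ` such that some path of length `ℓ` has weight at most `λℓ`
(`0` if there is none). -/
noncomputable def L (n : ℕ) (lam : ℝ) (ω : Sym2 (Fin n) → ℝ) : ℕ :=
  sSup {ℓ : ℕ | ∃ γ : Path n ℓ, weight ω γ ≤ lam * ℓ}
lemma edge_injective {n ℓ : ℕ} (γ : Path n ℓ) : Function.Injective γ.edge := by
  intro i k h
  unfold Path.edge at h
  rw [Sym2.eq_iff] at h
  rcases h with ⟨h1, _⟩ | ⟨h1, h2⟩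
  · exact Fin.castSucc_injective _ (γ.2 h1)
  · have h1 := congrArg Fin.val (γ.2 h1)
    have h2 := congrArg Fin.val (γ.2 h2)
    simp at h1 h2
    omega

lemma map_edge {n ℓ : ℕ} (hn : 0 < n) (γ : Path n ℓ) :
    (P n).map (fun ω i => ω (γ.edge i)) = Measure.pi fun _ : Fin ℓ => expMeasure ((n : ℝ)⁻¹) := by
  have hp : IsProbabilityMeasure (expMeasure ((n : ℝ)⁻¹)) :=
    isProbabilityMeasure_expMeasure (by positivity)
  have hind : iIndepFun (fun (e : Sym2 (Fin n)) (ω : Sym2 (Fin n) → ℝ) => ω e) (P n) := by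
    have := iIndepFun_pi (μ := fun _ : Sym2 (Fin n) => expMeasure ((n : ℝ)⁻¹))
      (X := fun _ x => x) (fun i => aemeasurable_id)
    exact this
  have h2 := hind.precomp (edge_injective γ)
  have h3 := h2.map_fun_eq_pi_map (fun i => (measurable_pi_apply _).aemeasurable)
  refine Eq.trans h3 ?_
  congr 1
  funext i
  exact (measurePreserving_eval (fun _ : Sym2 (Fin n) => expMeasure ((n : ℝ)⁻¹)) (γ.edge i)).map_eq

/-- the block difference coefficients -/
noncomputable def cf (m j i : ℕ) : ℝ :=
  (if i < (2 * j + 2) * m then 1 else 0) - 2 * (if i < (2 * j + 1) * m then 1 else 0)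
    + (if i < (2 * j) * m then 1 else 0)

lemma cf_lt {m j i : ℕ} (h : i < 2 * m * j) : cf m j i = 0 := by
  have h1 : i < (2 * j + 2) * m := by nlinarith
  have h2 : i < (2 * j + 1) * m := by nlinarith
  have h3 : i < (2 * j) * m := by nlinarith
  simp [cf, h1, h2, h3]; norm_num

lemma cf_ge {m j i : ℕ} (h : 2 * m * (j + 1) ≤ i) : cf m j i = 0 := by
  have h1 : ¬ i < (2 * j + 2) * m := by nlinarith
  have h2 : ¬ i < (2 * j + 1) * m := by nlinarith
  have h3 : ¬ i < (2 * j) * m := by nlinarith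
  simp [cf, h1, h2, h3]

lemma cf_mid {m j i : ℕ} (h : 2 * m * j ≤ i) (h' : i < 2 * m * (j + 1)) : |cf m j i| = 1 := by
  have h1 : i < (2 * j + 2) * m := by nlinarith
  have h3 : ¬ i < (2 * j) * m := by nlinarith
  by_cases h2 : i < (2 * j + 1) * m
  · simp [cf, h1, h2, h3]; norm_num
  · simp [cf, h1, h2, h3]

lemma sum_cf {ℓ : ℕ} (m j : ℕ) (x : Fin ℓ → ℝ) :
    ∑ i : Fin ℓ, cf m j i * x i =
      (∑ i : Fin ℓ, if (i : ℕ) < (2 * j + 2) * m then x i else 0)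
      - 2 * (∑ i : Fin ℓ, if (i : ℕ) < (2 * j + 1) * m then x i else 0)
      + (∑ i : Fin ℓ, if (i : ℕ) < (2 * j) * m then x i else 0) := by
  rw [Finset.mul_sum, ← Finset.sum_sub_distrib, ← Finset.sum_add_distrib]
  refine Finset.sum_congr rfl fun i _ => ?_
  unfold cf
  split_ifs <;> ring

lemma dev_le {n ℓ : ℕ} (ω : Sym2 (Fin n) → ℝ) (γ : Path n ℓ) {k : ℕ} (hk : k ≤ ℓ) {M : ℝ}
    (hM : 0 ≤ M) (h : deviation ω γ ≤ M) :
    |partialSum ω γ k - ((k : ℝ) / ℓ) * weight ω γ| ≤ M := by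
  rcases Nat.eq_zero_or_pos k with rfl | hk0
  · simpa [partialSum] using hM
  · obtain ⟨k, rfl⟩ : ∃ k', k = k' + 1 := ⟨k - 1, by omega⟩
    refine le_trans ?_ h
    unfold deviation
    have := le_ciSup (f := fun k : Fin ℓ =>
      |partialSum ω γ ((k : ℕ) + 1) - (((k : ℕ) + 1 : ℝ) / ℓ) * weight ω γ|)
      (Set.finite_range _).bddAbove ⟨k, by omega⟩
    simpa using this

lemma block_le {n ℓ : ℕ} (ω : Sym2 (Fin n) → ℝ) (γ : Path n ℓ) {m j : ℕ}
    (hk : 2 * m * (j + 1) ≤ ℓ) {M : ℝ} (hM : 0 ≤ M) (h : deviation ω γ ≤ M) :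
    |∑ i : Fin ℓ, cf m j i * ω (γ.edge i)| ≤ 4 * M := by
  have h1 := dev_le ω γ (k := (2 * j + 2) * m) (by nlinarith) hM h
  have h2 := dev_le ω γ (k := (2 * j + 1) * m) (by nlinarith) hM h
  have h3 := dev_le ω γ (k := (2 * j) * m) (by nlinarith) hM h
  rw [sum_cf m j (fun i => ω (γ.edge i))]
  change |partialSum ω γ _ - 2 * partialSum ω γ _ + partialSum ω γ _| ≤ _
  have e : (((2 * j + 2) * m : ℕ) : ℝ) / ℓ * weight ω γ
     - 2 * ((((2 * j + 1) * m : ℕ) : ℝ) / ℓ * weight ω γ)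
     + (((2 * j) * m : ℕ) : ℝ) / ℓ * weight ω γ = 0 := by push_cast; ring
  rw [abs_le] at *
  constructor <;> linarith [h1.1, h1.2, h2.1, h2.2, h3.1, h3.2]

lemma card_block {ℓ A B : ℕ} (hB : B ≤ ℓ) :
    (univ.filter (fun i : Fin ℓ => A ≤ (i : ℕ) ∧ (i : ℕ) < B)).card = B - A := by
  rw [← Nat.card_Ico, ← Finset.card_map Fin.valEmbedding]
  congr 1
  ext i
  simp only [Finset.mem_map, Finset.mem_filter, Finset.mem_univ, true_and, Fin.valEmbedding_apply,
    Finset.mem_Ico]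
  constructor
  · rintro ⟨a, h, rfl⟩; exact h
  · intro h; exact ⟨⟨i, by omega⟩, h, rfl⟩

section core
variable {ℓ : ℕ} (μ : Measure ℝ) [IsProbabilityMeasure μ] (s θ K ρ : ℝ) (m : ℕ)

noncomputable def kern (a : Fin ℓ → ℝ) (x : Fin ℓ → ℝ) : ℂ :=
  ∏ i, Complex.exp ((-(s : ℂ) + Complex.I * (θ * a i : ℝ)) * x i)

noncomputable def fac (J : ℕ) (x : Fin ℓ → ℝ) : ℝ :=
  ∏ j ∈ range J, (1 + Real.cos (θ * ∑ i : Fin ℓ, cf m j i * x i))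

lemma fac_nonneg (J : ℕ) (x : Fin ℓ → ℝ) : 0 ≤ fac θ m J x :=
  Finset.prod_nonneg fun j _ => by linarith [Real.neg_one_le_cos (θ * ∑ i : Fin ℓ, cf m j i * x i)]

lemma fac_le (J : ℕ) (x : Fin ℓ → ℝ) : fac θ m J x ≤ 2 ^ J := by
  unfold fac
  calc _ ≤ ∏ j ∈ range J, (2 : ℝ) := Finset.prod_le_prod (fun j _ => ?_) (fun j _ => ?_)
    _ = 2 ^ J := by simp
  · linarith [Real.neg_one_le_cos (θ * ∑ i : Fin ℓ, cf m j i * x i)]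
  · linarith [Real.cos_le_one (θ * ∑ i : Fin ℓ, cf m j i * x i)]

lemma fac_cont (J : ℕ) : Continuous (fac (ℓ := ℓ) θ m J) := by
  unfold fac; fun_prop

lemma kern_int (hexpint : Integrable (fun x : ℝ => Real.exp (-s * x)) μ) (a : Fin ℓ → ℝ) :
    Integrable (kern s θ a) (Measure.pi fun _ => μ) := by
  unfold kern
  apply Integrable.fintype_prod
    (f := fun i (y : ℝ) => Complex.exp ((-(s : ℂ) + Complex.I * (θ * a i : ℝ)) * y))
  intro i
  refine hexpint.mono' (by fun_prop) (ae_of_all _ fun y => ?_)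
  rw [Complex.norm_exp]
  simp

lemma kern_fac_int (hexpint : Integrable (fun x : ℝ => Real.exp (-s * x)) μ) (a : Fin ℓ → ℝ) (J : ℕ) :
    Integrable (fun x => kern s θ a x * (fac θ m J x : ℝ)) (Measure.pi fun _ => μ) := by
  refine (kern_int μ s θ hexpint a).mul_bdd (c := 2 ^ J) ?_ (ae_of_all _ fun x => ?_)
  · exact (Complex.continuous_ofReal.comp (fac_cont θ m J)).aestronglyMeasurable
  · rw [Complex.norm_real, Real.norm_eq_abs, abs_of_nonneg (fac_nonneg _ _ _ _)]
    exact fac_le _ _ _ _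

lemma kern_add (a b x : Fin ℓ → ℝ) :
    kern s θ (a + b) x = kern s θ a x * Complex.exp (Complex.I * (θ * ∑ i, b i * x i : ℝ)) := by
  unfold kern
  rw [← Complex.exp_sum, ← Complex.exp_sum, ← Complex.exp_add]
  congr 1
  push_cast
  rw [Finset.mul_sum, Finset.mul_sum, ← Finset.sum_add_distrib]
  refine Finset.sum_congr rfl fun i _ => ?_
  simp only [Pi.add_apply]
  push_cast
  ring

lemma core (hexpint : Integrable (fun x : ℝ => Real.exp (-s * x)) μ)
    (h0 : ‖∫ y : ℝ, Complex.exp (-(s : ℂ) * y) ∂μ‖ ≤ K)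
    (h1 : ∀ a : ℝ, |a| = 1 →
      ‖∫ y : ℝ, Complex.exp ((-(s : ℂ) + Complex.I * (θ * a : ℝ)) * y) ∂μ‖ ≤ K * ρ)
    (J : ℕ) : 2 * m * J ≤ ℓ → ∀ a : Fin ℓ → ℝ, (∀ i, a i = 0 ∨ |a i| = 1) →
      (∀ i : Fin ℓ, (i : ℕ) < 2 * m * J → a i = 0) →
    ‖∫ x, kern s θ a x * (fac θ m J x : ℝ) ∂(Measure.pi fun _ : Fin ℓ => μ)‖ ≤
      K ^ ℓ * ρ ^ (univ.filter (fun i => a i ≠ 0)).card * (1 + ρ ^ (2 * m)) ^ J := by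
  induction J with
  | zero =>
    intro _ a ha _
    simp only [fac, Finset.range_zero, Finset.prod_empty, Complex.ofReal_one, mul_one, pow_zero]
    unfold kern
    rw [integral_fintype_prod_eq_prod
      (f := fun i (y : ℝ) => Complex.exp ((-(s : ℂ) + Complex.I * (θ * a i : ℝ)) * y)), norm_prod]
    calc _ ≤ ∏ i : Fin ℓ, (K * if a i ≠ 0 then ρ else 1) := by
          refine Finset.prod_le_prod (fun _ _ => norm_nonneg _) fun i _ => ?_
          rcases ha i with h | h
          · simpa [h] using h0
          · have : a i ≠ 0 := by intro h'; simp [h'] at h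
            simpa [this] using h1 _ h
      _ = _ := by
          rw [Finset.prod_mul_distrib, Finset.prod_ite]
          simp
  | succ J ih =>
    intro hJ a ha ha0
    have hJ' : 2 * m * J ≤ ℓ := by nlinarith
    specialize ih hJ'
    have hmono : ∀ i : Fin ℓ, (i : ℕ) < 2 * m * J → a i = 0 := fun i hi => ha0 i (by nlinarith)
    set c : Fin ℓ → ℝ := fun i => cf m J i with hc
    have key : ∀ b : Fin ℓ → ℝ, (∀ i, |b i| = |c i|) →
        ‖∫ x, kern s θ (a + b) x * (fac θ m J x : ℝ) ∂(Measure.pi fun _ : Fin ℓ => μ)‖ ≤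
        K ^ ℓ * ρ ^ (univ.filter (fun i => a i ≠ 0)).card * ρ ^ (2 * m) *
          (1 + ρ ^ (2 * m)) ^ J := by
      intro b hb
      have hb0 : ∀ i : Fin ℓ, ¬ (2 * m * J ≤ (i : ℕ) ∧ (i : ℕ) < 2 * m * (J + 1)) → b i = 0 := by
        intro i hi
        rw [← abs_eq_zero, hb i, abs_eq_zero]
        by_cases h : (i : ℕ) < 2 * m * J
        · exact cf_lt h
        · exact cf_ge (by by_contra h'; exact hi ⟨by omega, by omega⟩)
      have hb1 : ∀ i : Fin ℓ, (2 * m * J ≤ (i : ℕ) ∧ (i : ℕ) < 2 * m * (J + 1)) → |b i| = 1 := by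
        intro i hi
        rw [hb i]; exact cf_mid hi.1 hi.2
      have := ih (a + b) ?_ ?_
      · refine this.trans_eq ?_
        have hcard : (univ.filter (fun i => (a + b) i ≠ 0)).card =
            (univ.filter (fun i => a i ≠ 0)).card + 2 * m := by
          have : 2 * m = 2 * m * (J + 1) - 2 * m * J := by
            rw [Nat.mul_succ]; omega
          rw [this, ← card_block (A := 2 * m * J) hJ, ← Finset.card_union_of_disjoint]
          · congr 1
            ext i
            simp only [Finset.mem_filter, Finset.mem_univ, true_and, Finset.mem_union, Pi.add_apply]
            by_cases hi : (2 * m * J ≤ (i : ℕ) ∧ (i : ℕ) < 2 * m * (J + 1))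
            · have := hb1 i hi
              have hbi : b i ≠ 0 := by intro h'; simp [h'] at this
              simp [ha0 i hi.2, hbi, hi]
            · simp [hb0 i hi, hi]
          · rw [Finset.disjoint_left]
            intro i hi hi'
            simp only [Finset.mem_filter, Finset.mem_univ, true_and] at hi hi'
            exact hi (ha0 i hi'.2)
        rw [hcard, pow_add]; ring
      · intro i
        by_cases hi : (2 * m * J ≤ (i : ℕ) ∧ (i : ℕ) < 2 * m * (J + 1))
        · right; simp [ha0 i hi.2, hb1 i hi]
        · simpa [hb0 i hi] using ha i
      · intro i hi
        simp [hmono i hi, hb0 i (by omega)]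
    have e : ∀ x, kern s θ a x * (fac θ m (J + 1) x : ℝ) =
        kern s θ a x * (fac θ m J x : ℝ) +
        ((1 / 2 : ℂ) * (kern s θ (a + c) x * (fac θ m J x : ℝ)) +
         (1 / 2 : ℂ) * (kern s θ (a + -c) x * (fac θ m J x : ℝ))) := by
      intro x
      have hf : fac θ m (J + 1) x = fac θ m J x * (1 + Real.cos (θ * ∑ i, c i * x i)) := by
        unfold fac; rw [Finset.prod_range_succ]
      rw [hf, kern_add, kern_add]
      push_cast
      rw [Complex.cos]
      have : (θ : ℂ) * ∑ i, ((-c) i : ℂ) * (x i : ℂ) = - (θ * ∑ i, (c i : ℂ) * (x i : ℂ)) := by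
        simp [Finset.sum_neg_distrib]
      rw [this, mul_comm Complex.I, mul_comm Complex.I]
      ring
    simp_rw [e]
    have i1 := kern_fac_int μ s θ m hexpint a J
    have i2 := (kern_fac_int μ s θ m hexpint (a + c) J).const_mul (1 / 2 : ℂ)
    have i3 := (kern_fac_int μ s θ m hexpint (a + -c) J).const_mul (1 / 2 : ℂ)
    rw [integral_add i1 (by exact i2.add i3), integral_add i2 i3, integral_const_mul, integral_const_mul]
    have k1 := ih a ha hmono
    have k2 := key c (fun _ => rfl)
    have k3 := key (-c) (fun i => by simp)
    calc _ ≤ ‖∫ x, kern s θ a x * (fac θ m J x : ℝ) ∂(Measure.pi fun _ : Fin ℓ => μ)‖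
          + (1 / 2 * ‖∫ x, kern s θ (a + c) x * (fac θ m J x : ℝ) ∂(Measure.pi fun _ : Fin ℓ => μ)‖
          + 1 / 2 * ‖∫ x, kern s θ (a + -c) x * (fac θ m J x : ℝ)
              ∂(Measure.pi fun _ : Fin ℓ => μ)‖) := by
          refine (norm_add_le _ _).trans (add_le_add le_rfl ((norm_add_le _ _).trans ?_))
          simp
      _ ≤ _ := by
          rw [pow_succ]
          linarith

end core

lemma integral_expMeasure {r : ℝ} (hr : 0 < r) (g : ℝ → ℂ) :
    ∫ y, g y ∂(expMeasure r) = ∫ y in Set.Ioi 0, (r * Real.exp (-(r * y)) : ℝ) * g y := by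
  have : expMeasure r = volume.withDensity (fun y => ENNReal.ofReal (exponentialPDFReal r y)) := rfl
  rw [this, integral_withDensity_eq_integral_toReal_smul (by fun_prop) (by simp),
    ← integral_Ici_eq_integral_Ioi, ← integral_indicator measurableSet_Ici]
  congr 1
  funext y
  have h2 := exponentialPDF_eq r y
  unfold exponentialPDF at h2
  rw [h2]
  by_cases hy : 0 ≤ y
  · have : 0 ≤ r * Real.exp (-(r * y)) := by positivity
    simp only [Set.indicator, Set.mem_Ici, hy, if_true, ENNReal.toReal_ofReal this,
      Complex.real_smul]
  · simp [Set.indicator, hy]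

lemma integral_exp_expMeasure {r : ℝ} (hr : 0 < r) (z : ℂ) (hz : z.re ≤ 0) :
    ∫ y : ℝ, Complex.exp (z * y) ∂(expMeasure r) = r / (r - z) := by
  rw [integral_expMeasure hr]
  have : ∀ y : ℝ, ((r * Real.exp (-(r * y)) : ℝ) : ℂ) * Complex.exp (z * y) =
      r * Complex.exp ((z - r) * y) := by
    intro y
    push_cast
    rw [mul_assoc, ← Complex.exp_add]
    congr 2
    ring
  simp_rw [this]
  have hre : (z - r).re < 0 := by simp; linarith
  rw [integral_const_mul, integral_exp_mul_complex_Ioi hre]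
  have h1 : z - r ≠ 0 := by intro h; rw [h] at hre; simp at hre
  have h2 : (r : ℂ) - z ≠ 0 := by intro h; apply h1; linear_combination -h
  simp
  field_simp
  ring

lemma norm_integral_le {r s t : ℝ} (hr : 0 < r) (hs : 0 < s) :
    ‖∫ y : ℝ, Complex.exp ((-(s : ℂ) + Complex.I * (t : ℝ)) * y) ∂(expMeasure r)‖ ≤
      r / Real.sqrt (s ^ 2 + t ^ 2) := by
  rw [integral_exp_expMeasure hr _ (by simp; linarith), norm_div, Complex.norm_real,
    Real.norm_of_nonneg hr.le]
  refine div_le_div_of_nonneg_left hr.le (by positivity) ?_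
  rw [Complex.norm_def]
  apply Real.sqrt_le_sqrt
  rw [Complex.normSq_apply]
  simp
  nlinarith

lemma integrable_exp_expMeasure {r s : ℝ} (hr : 0 < r) (hs : 0 < s) :
    Integrable (fun x : ℝ => Real.exp (-s * x)) (expMeasure r) := by
  have hp := isProbabilityMeasure_expMeasure hr
  refine Integrable.of_bound (by fun_prop) 1 ?_
  have hneg : expMeasure r (Set.Iio 0) = 0 := by
    have : expMeasure r = volume.withDensity (exponentialPDF r) := rfl
    rw [this, withDensity_apply _ measurableSet_Iio]
    exact lintegral_exponentialPDF_of_nonpos le_rfl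
  have : ∀ᵐ x ∂(expMeasure r), 0 ≤ x := by
    rw [ae_iff]; simpa [Set.Iio] using hneg
  filter_upwards [this] with x hx
  rw [Real.norm_of_nonneg (Real.exp_pos _).le, Real.exp_le_one_iff]
  nlinarith

lemma path_bound {n ℓ : ℕ} (hn : 0 < n) (γ : Path n ℓ) {M lam : ℝ} (hM : 0 < M) {m J : ℕ}
    (hJ : 2 * m * J ≤ ℓ) (hm : 3 * (4 * M) ^ 2 * Real.exp 1 ^ 2 ≤ m) :
    (P n).real {ω | weight ω γ ≤ lam * ℓ ∧ deviation ω γ ≤ M} ≤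
      Real.exp (Real.exp 1 * lam * ℓ) * ((n : ℝ)⁻¹ / Real.exp 1) ^ ℓ * (5 / 6) ^ J := by
  set s := Real.exp 1 with hs
  have hs0 : 0 < s := Real.exp_pos _
  set r := (n : ℝ)⁻¹ with hr
  have hr0 : 0 < r := by positivity
  set θ : ℝ := (4 * M)⁻¹ with hθ
  have hθ0 : 0 < θ := by positivity
  set ρ := s / Real.sqrt (s ^ 2 + θ ^ 2) with hρ
  have hρ0 : 0 ≤ ρ := by positivity
  have hp := isProbabilityMeasure_expMeasure hr0
  have hpP : IsProbabilityMeasure (P n) := by unfold P; infer_instance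
  set μ := expMeasure r
  set ν := Measure.pi (fun _ : Fin ℓ => μ) with hν
  have hexpint : Integrable (fun x : ℝ => Real.exp (-s * x)) μ := integrable_exp_expMeasure hr0 hs0
  have hρm : ρ ^ (2 * m) ≤ 1 / 4 := by
    rw [pow_mul, hρ, div_pow, Real.sq_sqrt (by positivity)]
    have e1 : s ^ 2 / (s ^ 2 + θ ^ 2) = (1 + θ ^ 2 / s ^ 2)⁻¹ := by field_simp
    rw [e1, inv_pow, one_div]
    apply inv_anti₀ (by norm_num)
    have := one_add_mul_le_pow (a := θ ^ 2 / s ^ 2) (by have : 0 ≤ θ ^ 2 / s ^ 2 := by positivity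
                                                        linarith) m
    refine le_trans ?_ this
    have : 3 ≤ m * (θ ^ 2 / s ^ 2) := by
      calc (3 : ℝ) = (3 * (4 * M) ^ 2 * s ^ 2) * (θ ^ 2 / s ^ 2) := by
            rw [hθ]; field_simp
        _ ≤ _ := by gcongr
    linarith
  have hcore := core (ℓ := ℓ) μ s θ (r / s) ρ m hexpint
    (by have := norm_integral_le (t := 0) hr0 hs0
        simpa [Real.sqrt_sq hs0.le] using this)
    (by intro a ha
        refine (norm_integral_le hr0 hs0).trans_eq ?_
        have : (θ * a) ^ 2 = θ ^ 2 := by rw [mul_pow, ← sq_abs a, ha]; ring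
        rw [this, hρ]; field_simp)
    J hJ 0 (by simp) (by simp)
  set F : (Fin ℓ → ℝ) → ℝ := fun x => Real.exp (-s * ∑ i, x i) * fac θ m J x with hF
  have hker : ∀ x, kern s θ 0 x * (fac θ m J x : ℝ) = ((F x : ℝ) : ℂ) := by
    intro x
    simp only [kern, hF]
    rw [← Complex.exp_sum]
    push_cast
    rw [Finset.mul_sum]
    simp
  have hFint : Integrable F ν := by
    have := (kern_fac_int (ℓ := ℓ) μ s θ m hexpint 0 J).re
    refine this.congr (ae_of_all _ fun x => ?_)
    simp only [hker]; simp
  have hF0 : ∀ x, 0 ≤ F x := fun x => mul_nonneg (Real.exp_pos _).le (fac_nonneg _ _ _ _)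
  have hFcont : Continuous F := by
    have := fac_cont (ℓ := ℓ) θ m J
    simp only [hF]; fun_prop
  have hIF : ∫ x, F x ∂ν ≤ (r / s) ^ ℓ * (5 / 4) ^ J := by
    simp_rw [hker] at hcore
    rw [integral_complex_ofReal, Complex.norm_real, Real.norm_of_nonneg (integral_nonneg hF0)] at hcore
    refine hcore.trans ?_
    simp only [Pi.zero_apply, ne_eq, not_true_eq_false, Finset.filter_false, Finset.card_empty,
      pow_zero, mul_one]
    gcongr
    linarith
  set ε := Real.exp (-(s * lam * ℓ)) * (3 / 2) ^ J with hε
  have hε0 : 0 < ε := by positivity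
  have hmarkov := mul_meas_ge_le_integral_of_nonneg (ae_of_all ν hF0) hFint ε
  have hsub : {ω : Sym2 (Fin n) → ℝ | weight ω γ ≤ lam * ℓ ∧ deviation ω γ ≤ M} ⊆
      (fun ω i => ω (γ.edge i)) ⁻¹' {x : Fin ℓ → ℝ | ε ≤ F x} := by
    rintro ω ⟨hw, hd⟩
    simp only [Set.mem_preimage, Set.mem_ofPred_eq, hF, hε]
    apply mul_le_mul _ _ (by positivity) (Real.exp_pos _).le
    · apply Real.exp_le_exp.2
      unfold weight at hw
      nlinarith
    · unfold fac
      calc (3 / 2 : ℝ) ^ J = ∏ j ∈ range J, (3 / 2 : ℝ) := by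
            rw [Finset.prod_const, Finset.card_range]
        _ ≤ _ := by
          refine Finset.prod_le_prod (fun _ _ => by norm_num) fun j hj => ?_
          have hj' : 2 * m * (j + 1) ≤ ℓ :=
            le_trans (Nat.mul_le_mul_left _ (Finset.mem_range.1 hj)) hJ
          have hb := block_le ω γ hj' hM.le hd
          set D := ∑ i : Fin ℓ, cf m j i * ω (γ.edge i)
          have h1 := Real.one_sub_sq_div_two_le_cos (x := θ * D)
          have h2 : |θ * D| ≤ 1 := by
            rw [abs_mul, abs_of_pos hθ0]
            calc θ * |D| ≤ θ * (4 * M) := by gcongr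
              _ = 1 := by rw [hθ]; field_simp
          have h3 : (θ * D) ^ 2 ≤ 1 := by rw [← sq_abs]; exact pow_le_one₀ (abs_nonneg _) h2
          linarith
  have hle : (P n).real {ω | weight ω γ ≤ lam * ℓ ∧ deviation ω γ ≤ M} ≤
      ν.real {x | ε ≤ F x} := by
    refine (measureReal_mono hsub).trans_eq ?_
    rw [hν, ← map_edge hn γ, map_measureReal_apply (by fun_prop)
      (measurableSet_le measurable_const hFcont.measurable)]
  have h1 : ε * (P n).real {ω | weight ω γ ≤ lam * ℓ ∧ deviation ω γ ≤ M} ≤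
      (r / s) ^ ℓ * (5 / 4) ^ J :=
    (mul_le_mul_of_nonneg_left hle hε0.le).trans (hmarkov.trans hIF)
  rw [← le_div_iff₀' hε0] at h1
  refine h1.trans_eq ?_
  rw [hε, Real.exp_neg]
  have : (5 / 6 : ℝ) ^ J = (5 / 4) ^ J / (3 / 2) ^ J := by rw [← div_pow]; norm_num
  rw [this]
  field_simp

lemma len_bound {n ℓ : ℕ} (hn : 0 < n) {L : ℝ} (hLn : L = Real.log n) (hL : 1 ≤ L)
    (h1 : L ^ 3 / (1 / 1000000) ≤ ℓ) (h2 : (ℓ : ℝ) ≤ 2 * (L ^ 3 / (1 / 1000000) + 1)) :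
    (P n).real (⋃ γ : Path n ℓ, {ω | weight ω γ ≤
        (Real.exp (-1) + 1 / 1000000 * (L ^ 2)⁻¹) * ℓ ∧ deviation ω γ ≤ 3 * L}) ≤
      6 / 5 * Real.exp (-(16 * L)) := by
  have hL0 : 0 < L := by linarith
  have hn0 : (0 : ℝ) < n := by exact_mod_cast hn
  have hexpL : Real.exp L = n := by rw [hLn, Real.exp_log hn0]
  have he3 : Real.exp 1 ≤ 2.7182818286 := Real.exp_one_lt_d9.le
  have he0 : 0 < Real.exp 1 := Real.exp_pos _
  have he2 : Real.exp 1 ^ 2 ≤ 8 := by nlinarith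
  set m : ℕ := ⌈3456 * L ^ 2⌉₊ with hm
  have hm1 : 3456 * L ^ 2 ≤ m := Nat.le_ceil _
  have hm2 : (m : ℝ) ≤ 3457 * L ^ 2 := by
    have := (Nat.ceil_lt_add_one (a := 3456 * L ^ 2) (by positivity)).le
    nlinarith
  have hm0 : (0 : ℝ) < m := by nlinarith
  have hm0' : 0 < m := by exact_mod_cast hm0
  set J : ℕ := ℓ / (2 * m) with hJ
  have hJ1 : 2 * m * J ≤ ℓ := Nat.mul_div_le _ _
  have hJ2 : (ℓ : ℝ) ≤ 2 * m * (J + 1) := by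
    have := (Nat.lt_mul_div_succ ℓ (show 0 < 2 * m by omega)).le
    exact_mod_cast this
  have hJ3 : 144 * L ≤ (J : ℝ) + 1 := by
    have h3 : 1000000 * L ^ 3 ≤ 2 * (3457 * L ^ 2) * ((J : ℝ) + 1) := by
      calc 1000000 * L ^ 3 = L ^ 3 / (1 / 1000000) := by ring
        _ ≤ (ℓ : ℝ) := h1
        _ ≤ _ := hJ2
        _ ≤ _ := by gcongr
    have h4 : L ^ 2 * (1000000 * L) ≤ L ^ 2 * (6914 * ((J : ℝ) + 1)) := by
      calc _ = 1000000 * L ^ 3 := by ring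
        _ ≤ _ := h3
        _ = _ := by ring
    have := le_of_mul_le_mul_left h4 (by positivity)
    linarith
  have hq : (5 / 6 : ℝ) ^ J ≤ 6 / 5 * Real.exp (-(24 * L)) := by
    have h5 : (5 / 6 : ℝ) ≤ Real.exp (-1 / 6) := by
      have := Real.add_one_le_exp (-1 / 6 : ℝ)
      linarith
    have h6 : (5 / 6 : ℝ) ^ (J + 1) ≤ Real.exp (-(24 * L)) := by
      calc _ ≤ Real.exp (-1 / 6) ^ (J + 1) := by gcongr
        _ = Real.exp (((J + 1 : ℕ) : ℝ) * (-1 / 6)) := by rw [Real.exp_nat_mul]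
        _ ≤ _ := by
          apply Real.exp_le_exp.2
          push_cast
          linarith
    rw [pow_succ] at h6
    linarith
  have hone : ∀ γ : Path n ℓ, (P n).real {ω | weight ω γ ≤
        (Real.exp (-1) + 1 / 1000000 * (L ^ 2)⁻¹) * ℓ ∧ deviation ω γ ≤ 3 * L} ≤
      ((n : ℝ)⁻¹) ^ ℓ * (Real.exp (7 * L) * (6 / 5 * Real.exp (-(24 * L)))) := by
    intro γ
    have := path_bound hn γ (M := 3 * L) (lam := Real.exp (-1) + 1 / 1000000 * (L ^ 2)⁻¹)
      (by positivity) hJ1 (by nlinarith [sq_nonneg L])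
    refine this.trans ?_
    rw [div_pow, ← Real.exp_nat_mul, mul_one]
    have e1 : Real.exp (Real.exp 1 * (Real.exp (-1) + 1 / 1000000 * (L ^ 2)⁻¹) * ℓ)
        = Real.exp ℓ * Real.exp (Real.exp 1 * (1 / 1000000 * (L ^ 2)⁻¹) * ℓ) := by
      rw [← Real.exp_add]
      congr 1
      have : Real.exp 1 * Real.exp (-1) = 1 := by rw [← Real.exp_add]; simp
      linear_combination (ℓ : ℝ) * this
    rw [e1]
    have e2 : Real.exp 1 * (1 / 1000000 * (L ^ 2)⁻¹) * ℓ ≤ 7 * L := by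
      have : Real.exp 1 * (1 / 1000000 * (L ^ 2)⁻¹) * ℓ
          ≤ 3 * (1 / 1000000 * (L ^ 2)⁻¹) * (2 * (L ^ 3 / (1 / 1000000) + 1)) := by
        gcongr
        linarith
      refine this.trans ?_
      have : 3 * (1 / 1000000 * (L ^ 2)⁻¹) * (2 * (L ^ 3 / (1 / 1000000) + 1)) =
        6 * L + 6 / 1000000 * (L ^ 2)⁻¹ := by
        field_simp; norm_num
      rw [this]
      have : (L ^ 2)⁻¹ ≤ 1 := inv_le_one_of_one_le₀ (by nlinarith)
      linarith
    calc _ = ((n : ℝ)⁻¹) ^ ℓ * (Real.exp (Real.exp 1 * (1 / 1000000 * (L ^ 2)⁻¹) * ℓ)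
            * (5 / 6) ^ J) := by field_simp
      _ ≤ _ := by gcongr
  have hcard : (Fintype.card (Path n ℓ) : ℝ) ≤ (n : ℝ) ^ (ℓ + 1) := by
    have h := Fintype.card_subtype_le (fun v : Fin (ℓ + 1) → Fin n => Function.Injective v)
    have h' : Fintype.card (Fin (ℓ + 1) → Fin n) = n ^ (ℓ + 1) := by simp
    rw [h'] at h
    have h2 : Fintype.card (Path n ℓ) ≤ n ^ (ℓ + 1) := by convert h
    exact_mod_cast h2
  calc _ ≤ ∑ γ : Path n ℓ, (P n).real {ω | weight ω γ ≤
        (Real.exp (-1) + 1 / 1000000 * (L ^ 2)⁻¹) * ℓ ∧ deviation ω γ ≤ 3 * L} :=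
        measureReal_iUnion_fintype_le _
    _ ≤ ∑ γ : Path n ℓ, ((n : ℝ)⁻¹) ^ ℓ * (Real.exp (7 * L) * (6 / 5 * Real.exp (-(24 * L)))) :=
        Finset.sum_le_sum fun γ _ => hone γ
    _ = Fintype.card (Path n ℓ) *
        (((n : ℝ)⁻¹) ^ ℓ * (Real.exp (7 * L) * (6 / 5 * Real.exp (-(24 * L))))) := by simp
    _ ≤ (n : ℝ) ^ (ℓ + 1) *
        (((n : ℝ)⁻¹) ^ ℓ * (Real.exp (7 * L) * (6 / 5 * Real.exp (-(24 * L))))) := by gcongr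
    _ = n * (Real.exp (7 * L) * (6 / 5 * Real.exp (-(24 * L)))) := by
        rw [pow_succ, inv_pow]; field_simp
    _ = _ := by
        rw [← hexpL]
        have : -(16 * L) = L + 7 * L + -(24 * L) := by ring
        rw [this, Real.exp_add, Real.exp_add]; ring

/-- Lemma 2.5: there is an absolute constant α > 0 such that, for λ_n = e⁻¹ + α (log n)⁻²
and ℓ_n = ⌈(log n)³/α⌉, the probability that some path of length ℓ' ∈ [ℓ_n, 2ℓ_n) has
weight at most λ_n ℓ' and deviation at most 3 log n tends to zero. -/
theorem no_light_path_with_small_deviation :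
    ∃ α : ℝ, 0 < α ∧
      Tendsto (fun n : ℕ =>
          P n {ω | ∃ ℓ' : ℕ, ⌈(Real.log n) ^ 3 / α⌉₊ ≤ ℓ' ∧ ℓ' < 2 * ⌈(Real.log n) ^ 3 / α⌉₊ ∧
            ∃ γ : Path n ℓ',
              weight ω γ ≤ (Real.exp (-1) + α * ((Real.log n) ^ 2)⁻¹) * ℓ' ∧
              deviation ω γ ≤ 3 * Real.log n})
        atTop (nhds 0) := by
  refine ⟨1 / 1000000, by norm_num, ?_⟩
  have hlog : Tendsto (fun n : ℕ => Real.log n) atTop atTop :=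
    Real.tendsto_log_atTop.comp tendsto_natCast_atTop_atTop
  have hlim : Tendsto (fun n : ℕ => ENNReal.ofReal
      (3000000 * (Real.log n ^ 3 * Real.exp (-Real.log n)))) atTop (nhds 0) := by
    have h := ((Real.tendsto_pow_mul_exp_neg_atTop_nhds_zero 3).comp hlog).const_mul 3000000
    have h' := ENNReal.tendsto_ofReal h
    simpa using h'
  refine tendsto_of_tendsto_of_tendsto_of_le_of_le' tendsto_const_nhds hlim
    (Eventually.of_forall fun _ => zero_le) ?_
  filter_upwards [hlog.eventually_ge_atTop 1, eventually_gt_atTop 0] with n hL hn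
  have hpP : IsProbabilityMeasure (P n) := by
    have hp := isProbabilityMeasure_expMeasure (r := (n : ℝ)⁻¹) (by positivity)
    unfold P; infer_instance
  obtain ⟨L, hLn⟩ : ∃ L, L = Real.log n := ⟨_, rfl⟩
  rw [← hLn] at hL ⊢
  set N : ℕ := ⌈L ^ 3 / (1 / 1000000)⌉₊ with hN
  have hN1 : L ^ 3 / (1 / 1000000) ≤ N := Nat.le_ceil _
  have hN2 : (N : ℝ) ≤ L ^ 3 / (1 / 1000000) + 1 :=
    (Nat.ceil_lt_add_one (by positivity)).le
  rw [← ofReal_measureReal (h := measure_ne_top _ _)]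
  apply ENNReal.ofReal_le_ofReal
  set A : ℕ → Set (Sym2 (Fin n) → ℝ) := fun ℓ => ⋃ γ : Path n ℓ, {ω | weight ω γ ≤
        (Real.exp (-1) + 1 / 1000000 * (L ^ 2)⁻¹) * ℓ ∧ deviation ω γ ≤ 3 * L} with hA
  calc _ ≤ (P n).real (⋃ ℓ ∈ Finset.Ico N (2 * N), A ℓ) := by
        refine measureReal_mono ?_ (measure_ne_top _ _)
        rintro ω ⟨ℓ, h1, h2, γ, h3, h4⟩
        simp only [Set.mem_iUnion, Finset.mem_Ico, hA]
        exact ⟨ℓ, ⟨h1, h2⟩, γ, h3, h4⟩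
    _ ≤ ∑ ℓ ∈ Finset.Ico N (2 * N), (P n).real (A ℓ) := measureReal_biUnion_finset_le _ _
    _ ≤ ∑ ℓ ∈ Finset.Ico N (2 * N), 6 / 5 * Real.exp (-(16 * L)) := by
        refine Finset.sum_le_sum fun ℓ hℓ => ?_
        rw [Finset.mem_Ico] at hℓ
        have h1 : (N : ℝ) ≤ ℓ := by exact_mod_cast hℓ.1
        have h2 : (ℓ : ℝ) ≤ 2 * N := by exact_mod_cast hℓ.2.le
        exact len_bound hn hLn hL (by linarith) (by linarith)
    _ = N * (6 / 5 * Real.exp (-(16 * L))) := by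
        rw [Finset.sum_const, Nat.card_Ico, nsmul_eq_mul]
        congr 2
        omega
    _ ≤ (L ^ 3 / (1 / 1000000) + 1) * (6 / 5 * Real.exp (-L)) := by
        gcongr
        linarith
    _ ≤ (2000000 * L ^ 3) * (6 / 5 * Real.exp (-L)) := by
        gcongr
        have : 1 ≤ L ^ 3 := one_le_pow₀ hL
        linarith
    _ ≤ _ := by
        have : 0 ≤ L ^ 3 * Real.exp (-L) := by positivity
        linarith

end Paper
end

section
/- Let 1/4 ≤ ρ ≤ 1 and r ≥ 1. For an integer s ≥ 1 let p_s = U_{ρs}^s( {z : max_{1≤k≤s} |Σ_{i=1}^k z_i − ρk| ≤ r} ), i.e. the probability that a vector distributed uniformly on the simplex Δ_{ρs}^s has all partial-sum deviations from the linear drift ρk at most r. Then for all integers j, k ≥ 1: p_{j+k} ≥ p_j · p_k / (10^8 · r · √(min(j,k))). -/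
open MeasureTheory ProbabilityTheory Filter Finset

namespace Paper

/-- The uniform probability measure `U_s^{k+1}` on the simplex
`Δ_s^{k+1} = {z ∈ ℝ_{≥0}^{k+1} : z_1 + ⋯ + z_{k+1} = s}`: the image of the normalized
Lebesgue measure on `{u ∈ ℝ_{≥0}^k : u_1 + ⋯ + u_k ≤ s}` under
`u ↦ (u_1, …, u_k, s - Σ_i u_i)`. It is the conditional law of `k+1` i.i.d. exponential
random variables given that their sum equals `s`. -/
noncomputable def simplexMeasure (k : ℕ) (s : ℝ) : Measure (Fin (k + 1) → ℝ) :=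
  Measure.map (fun u : Fin k → ℝ => Fin.snoc u (s - ∑ i, u i))
    ((volume {u : Fin k → ℝ | (∀ i, 0 ≤ u i) ∧ ∑ i, u i ≤ s})⁻¹ •
      volume.restrict {u : Fin k → ℝ | (∀ i, 0 ≤ u i) ∧ ∑ i, u i ≤ s})

/-- The event that all partial sums `z_1 + ⋯ + z_k`, `1 ≤ k ≤ m + 1`, deviate from the
drift `ρk` by at most `r`. -/
def devEvent (m : ℕ) (ρ r : ℝ) : Set (Fin (m + 1) → ℝ) :=
  {z | ∀ k : Fin (m + 1), |(∑ i, if i ≤ k then z i else 0) - ρ * ((k : ℕ) + 1)| ≤ r}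

/-- `p s` for `s = m + 1`: the probability, under the uniform measure on the simplex
`Δ_{ρs}^s`, that all partial-sum deviations from the drift `ρk` are at most `r`. -/
noncomputable def p (ρ r : ℝ) (m : ℕ) : ENNReal :=
  simplexMeasure m (ρ * ((m : ℝ) + 1)) (devEvent m ρ r)

/-- extension of a finite vector by zero -/
noncomputable def extz {m : ℕ} (u : Fin m → ℝ) (n : ℕ) : ℝ := if h : n < m then u ⟨n, h⟩ else 0

/-- partial sums -/
noncomputable def psum {m : ℕ} (u : Fin m → ℝ) (n : ℕ) : ℝ := ∑ i ∈ range n, extz u i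

/-- the set of admissible paths -/
def KK (m : ℕ) (ρ r : ℝ) : Set (Fin m → ℝ) :=
  {u | (∀ i, 0 ≤ u i) ∧ psum u m ≤ ρ * ((m : ℝ) + 1) ∧ ∀ n ≤ m, |psum u n - ρ * n| ≤ r}

lemma psum_all {m : ℕ} (u : Fin m → ℝ) : psum u m = ∑ i, u i := by
  unfold psum
  rw [Finset.sum_range]
  exact Finset.sum_congr rfl fun i _ => by simp [extz]

lemma psum_succ {m : ℕ} (u : Fin m → ℝ) (n : ℕ) : psum u (n + 1) = psum u n + extz u n := by
  unfold psum; rw [Finset.sum_range_succ]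

lemma psum_zero {m : ℕ} (u : Fin m → ℝ) : psum u 0 = 0 := by simp [psum]

lemma sum_le_eq {m : ℕ} (u : Fin m → ℝ) (k : Fin m) :
    (∑ i, if i ≤ k then u i else 0) = psum u (k + 1) := by
  have h1 : (∑ i : Fin m, if i ≤ k then u i else 0)
      = ∑ i ∈ range m, (if i ≤ (k : ℕ) then extz u i else 0) := by
    rw [Finset.sum_range]
    refine Finset.sum_congr rfl fun i _ => ?_
    have h : extz u (i : ℕ) = u i := dif_pos i.2
    rw [h]; rfl
  rw [h1, ← Finset.sum_filter]
  unfold psum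
  refine Finset.sum_congr (Finset.ext fun i => ?_) fun _ _ => rfl
  have := k.2
  simp only [Finset.mem_filter, Finset.mem_range]
  omega

lemma extz_continuous {m : ℕ} (n : ℕ) : Continuous (fun u : Fin m → ℝ => extz u n) := by
  unfold extz
  split_ifs
  · fun_prop
  · fun_prop

lemma psum_continuous {m : ℕ} (n : ℕ) : Continuous (fun u : Fin m → ℝ => psum u n) := by
  unfold psum
  exact continuous_finsetSum _ fun i _ => extz_continuous i

lemma KK_measurable (m : ℕ) (ρ r : ℝ) : MeasurableSet (KK m ρ r) := by
  apply IsClosed.measurableSet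
  unfold KK
  simp only [Set.ofPred_and, Set.ofPred_forall]
  refine IsClosed.inter ?_ (IsClosed.inter ?_ ?_)
  · exact isClosed_iInter fun i => isClosed_le continuous_const (continuous_apply i)
  · exact isClosed_le (psum_continuous m) continuous_const
  · refine isClosed_iInter fun i => isClosed_iInter fun _ => isClosed_le ?_ continuous_const
    exact ((psum_continuous i).sub continuous_const).abs

/-- the simplex -/
def SS (m : ℕ) (s : ℝ) : Set (Fin m → ℝ) := {u | (∀ i, 0 ≤ u i) ∧ ∑ i, u i ≤ s}

lemma SS_measurable (m : ℕ) (s : ℝ) : MeasurableSet (SS m s) := by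
  apply IsClosed.measurableSet
  unfold SS
  simp only [Set.ofPred_and, Set.ofPred_forall]
  refine IsClosed.inter ?_ ?_
  · exact isClosed_iInter fun i => isClosed_le continuous_const (continuous_apply i)
  · exact isClosed_le (by fun_prop) continuous_const

lemma devEvent_measurable (m : ℕ) (ρ r : ℝ) : MeasurableSet (devEvent m ρ r) := by
  apply IsClosed.measurableSet
  unfold devEvent
  simp only [Set.ofPred_forall]
  refine isClosed_iInter fun k => isClosed_le ?_ continuous_const
  refine Continuous.abs (Continuous.sub (continuous_finsetSum _ fun i _ => ?_) continuous_const)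
  split_ifs <;> fun_prop

lemma p_eq (ρ r : ℝ) (hr : 0 ≤ r) (m : ℕ) :
    p ρ r m = (volume (SS m (ρ * ((m : ℝ) + 1))))⁻¹ * volume (KK m ρ r) := by
  unfold p simplexMeasure
  have hmeas : Measurable (fun u : Fin m → ℝ =>
      (Fin.snoc u (ρ * ((m : ℝ) + 1) - ∑ i, u i) : Fin (m + 1) → ℝ)) := by
    rw [measurable_pi_iff]
    intro i
    refine Fin.lastCases ?_ (fun i => ?_) i
    · simp only [Fin.snoc_last]; fun_prop
    · simp only [Fin.snoc_castSucc]; fun_prop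
  rw [Measure.map_apply hmeas (devEvent_measurable m ρ r), Measure.smul_apply, smul_eq_mul,
    Measure.restrict_apply (hmeas (devEvent_measurable m ρ r))]
  change _ * volume (_ ∩ SS m (ρ * ((m : ℝ) + 1))) = _
  congr 2
  ext u
  simp only [Set.mem_inter_iff, Set.mem_preimage, devEvent, SS, KK, Set.mem_ofPred_eq, psum_all]
  have key : (∀ k : Fin (m + 1), |(∑ i, if i ≤ k then
      (Fin.snoc u (ρ * ((m : ℝ) + 1) - ∑ i, u i) : Fin (m + 1) → ℝ) i else 0)
        - ρ * ((k : ℕ) + 1)| ≤ r) ↔ ∀ n ≤ m, |psum u n - ρ * n| ≤ r := by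
    constructor
    · intro h n hn
      rcases n with _ | n
      · simpa [psum_zero] using hr
      · have := h (Fin.castSucc ⟨n, hn⟩)
        rw [Fin.sum_univ_castSucc] at this
        simp only [Fin.snoc_castSucc, Fin.snoc_last, Fin.castSucc_le_castSucc_iff, sum_le_eq] at this
        rw [if_neg (by simp [Fin.le_def]; omega)] at this
        simpa using this
    · intro h k
      refine Fin.lastCases ?_ (fun k => ?_) k
      · rw [Fin.sum_univ_castSucc]
        simp [Fin.le_last, hr]
      · rw [Fin.sum_univ_castSucc]
        simp only [Fin.snoc_castSucc, Fin.snoc_last, Fin.castSucc_le_castSucc_iff, sum_le_eq]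
        rw [if_neg (by simp [Fin.le_def])]
        simpa using h (k + 1) k.2
  rw [key]
  tauto

lemma volume_SS (m : ℕ) (s : ℝ) (hs : 0 ≤ s) :
    volume (SS m s) = ENNReal.ofReal (s ^ m / (m.factorial : ℝ)) := by
  induction m generalizing s with
  | zero =>
    have : SS 0 s = Set.univ := by
      ext u; simp [SS, hs]
    rw [this]; simp [volume_pi]
  | succ m ih =>
    have hmp := (volume_preserving_piFinSuccAbove (fun _ : Fin (m + 1) => ℝ) 0).symm
    rw [← hmp.measure_preimage (SS_measurable _ _).nullMeasurableSet]
    rw [Measure.volume_eq_prod, Measure.prod_apply (hmp.measurable (SS_measurable _ _))]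
    have hsec : ∀ x : ℝ, volume (Prod.mk x ⁻¹'
        ((MeasurableEquiv.piFinSuccAbove (fun _ : Fin (m + 1) => ℝ) 0).symm ⁻¹' SS (m + 1) s))
        = (Set.Icc 0 s).indicator
          (fun x => ENNReal.ofReal ((s - x) ^ m / (m.factorial : ℝ))) x := by
      intro x
      have hset : (Prod.mk x ⁻¹'
        ((MeasurableEquiv.piFinSuccAbove (fun _ : Fin (m + 1) => ℝ) 0).symm ⁻¹' SS (m + 1) s))
          = {w | 0 ≤ x ∧ w ∈ SS m (s - x)} := by
        ext w
        simp [SS, MeasurableEquiv.piFinSuccAbove, Fin.insertNthEquiv, Fin.forall_fin_succ,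
          Fin.sum_univ_succ, le_sub_iff_add_le', and_assoc]
      rw [hset]
      by_cases hx : x ∈ Set.Icc 0 s
      · rw [Set.indicator_of_mem hx, ← ih (s - x) (by linarith [hx.2])]
        simp [hx.1]
      · rw [Set.indicator_of_notMem hx]
        convert measure_empty (μ := volume)
        ext w
        simp only [Set.mem_ofPred_eq, Set.mem_empty_iff_false, iff_false, not_and]
        intro h0 hw
        have : 0 ≤ ∑ i, w i := Finset.sum_nonneg fun i _ => hw.1 i
        exact hx ⟨h0, by linarith [hw.2]⟩
    simp_rw [hsec]
    rw [lintegral_indicator measurableSet_Icc, ← ofReal_integral_eq_lintegral_ofReal]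
    · congr 1
      rw [integral_Icc_eq_integral_Ioc, ← intervalIntegral.integral_of_le hs]
      rw [intervalIntegral.integral_div, intervalIntegral.integral_comp_sub_left (fun x => x ^ m) s]
      simp only [sub_self, sub_zero, integral_pow]
      rw [Nat.factorial_succ]; push_cast
      have : (m.factorial : ℝ) ≠ 0 := by positivity
      field_simp
      simp
    · exact (Continuous.integrableOn_Icc (by fun_prop))
    · filter_upwards [ae_restrict_mem measurableSet_Icc] with x hx
      have : 0 ≤ s - x := by linarith [hx.2]
      simp only [Pi.zero_apply]
      positivity
/-- The gluing map. -/
noncomputable def vec (b : ℕ) (t : ℝ) : Fin b → ℝ := fun i => if (i : ℕ) = 0 then t else 0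

/-- The gluing map. -/
noncomputable def glue (a b : ℕ) (c : ℝ) (q : (Fin a → ℝ) × ℝ × (Fin b → ℝ)) :
    Fin (a + (b + 1)) → ℝ :=
  Fin.append q.1 (Fin.cons (c - (∑ i, q.1 i) - q.2.1) (q.2.2 + vec b q.2.1) : Fin (b + 1) → ℝ)

lemma mp_append (a b : ℕ) : MeasurePreserving
    (fun q : (Fin a → ℝ) × (Fin b → ℝ) => (Fin.append q.1 q.2 : Fin (a + b) → ℝ)) := by
  have h1 := volume_measurePreserving_sumPiEquivProdPi_symm (fun _ : Fin a ⊕ Fin b => ℝ)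
  have h2 := volume_measurePreserving_piCongrLeft (fun _ : Fin (a + b) => ℝ) finSumFinEquiv
  have h3 := h2.comp h1
  suffices h : (fun q : (Fin a → ℝ) × (Fin b → ℝ) => (Fin.append q.1 q.2 : Fin (a + b) → ℝ)) =
      (MeasurableEquiv.piCongrLeft (fun _ : Fin (a + b) => ℝ) finSumFinEquiv) ∘
        (MeasurableEquiv.sumPiEquivProdPi (fun _ : Fin a ⊕ Fin b => ℝ)).symm by
    rw [h]; exact h3
  ext q i
  refine Fin.addCases (fun i => ?_) (fun i => ?_) i
  · rw [Fin.append_left]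
    simp only [Function.comp]
    rw [← finSumFinEquiv_apply_left, MeasurableEquiv.coe_piCongrLeft, Equiv.piCongrLeft_apply_apply]
    rfl
  · rw [Fin.append_right]
    simp only [Function.comp]
    rw [← finSumFinEquiv_apply_right, MeasurableEquiv.coe_piCongrLeft,
      Equiv.piCongrLeft_apply_apply]
    rfl

lemma mp_cons (b : ℕ) : MeasurePreserving
    (fun q : ℝ × (Fin b → ℝ) => (Fin.cons q.1 q.2 : Fin (b + 1) → ℝ)) := by
  have := (volume_preserving_piFinSuccAbove (fun _ : Fin (b + 1) => ℝ) 0).symm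
  convert this using 1
  ext q i
  simp [MeasurableEquiv.piFinSuccAbove, Fin.insertNthEquiv]

lemma mp_glue (a b : ℕ) (c : ℝ) : MeasurePreserving (glue a b c) := by
  have hv : Measurable (vec b) := by
    unfold vec
    rw [measurable_pi_iff]; intro i
    split_ifs <;> fun_prop
  have h1 : ∀ d : ℝ, MeasurePreserving
      (fun q : ℝ × (Fin b → ℝ) => (d - q.1, q.2 + vec b q.1)) := by
    intro d
    refine MeasurePreserving.skew_product (f := fun t : ℝ => d - t)
      (g := fun t w => w + vec b t) (Measure.measurePreserving_sub_left volume d) ?_ ?_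
    · exact measurable_snd.add (hv.comp measurable_fst)
    · exact ae_of_all _ fun t => (measurePreserving_add_right volume (vec b t)).map_eq
  have h2 : MeasurePreserving (fun q : (Fin a → ℝ) × ℝ × (Fin b → ℝ) =>
      (q.1, (c - (∑ i, q.1 i) - q.2.1, q.2.2 + vec b q.2.1))) := by
    refine MeasurePreserving.skew_product (f := fun u : Fin a → ℝ => u)
      (g := fun u (q : ℝ × (Fin b → ℝ)) => (c - (∑ i, u i) - q.1, q.2 + vec b q.1)) (MeasurePreserving.id volume) ?_ ?_
    · refine Measurable.prodMk ?_ ?_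
      · fun_prop
      · exact (measurable_snd.comp measurable_snd).add
          (hv.comp (measurable_fst.comp measurable_snd))
    · exact ae_of_all _ fun u => (h1 _).map_eq
  exact (mp_append a (b + 1)).comp
    (((MeasurePreserving.id volume).prod (mp_cons b)).comp h2)
lemma fact_upper (n : ℕ) : ((n + 1).factorial : ℝ) ≤
    Real.exp 1 * √((n + 1 : ℕ) : ℝ) * (((n + 1 : ℕ) : ℝ) / Real.exp 1) ^ (n + 1) := by
  have h := Stirling.stirlingSeq'_antitone (Nat.zero_le n)
  simp only [Function.comp, Nat.succ_eq_add_one, zero_add, Stirling.stirlingSeq_one] at h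
  unfold Stirling.stirlingSeq at h
  rw [div_le_iff₀ (by positivity)] at h
  refine h.trans (le_of_eq ?_)
  rw [Real.sqrt_mul (by norm_num)]
  have : √(2 : ℝ) ≠ 0 := by positivity
  field_simp

lemma ratio_bound (a b : ℕ) :
    ((a + b + 2 : ℝ)) ^ (a + b + 1) / ((a + b + 1).factorial : ℝ) ≤
    4 * √((min (a + 1) (b + 1) : ℕ) : ℝ) *
      (((a + 1 : ℝ)) ^ a / (a.factorial : ℝ) * (((b + 1 : ℝ)) ^ b / (b.factorial : ℝ))) := by
  have e1 : ∀ n : ℕ, ((n : ℝ) + 1) ^ n / (n.factorial : ℝ)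
      = ((n + 1 : ℕ) : ℝ) ^ (n + 1) / ((n + 1).factorial : ℝ) := by
    intro n
    rw [Nat.factorial_succ]; push_cast
    have : (n.factorial : ℝ) ≠ 0 := by positivity
    field_simp
    ring
  have e2 := e1 (a + b + 1)
  have e3 : ((a + b + 2 : ℝ)) = ((a + b + 1 : ℕ) : ℝ) + 1 := by push_cast; ring
  rw [e3, e1, e1, e1]
  have hE : 0 < Real.exp 1 := Real.exp_pos 1
  have up : ∀ n : ℕ, ((n + 1 : ℕ) : ℝ) ^ (n + 1) / ((n + 1).factorial : ℝ)
      ≥ Real.exp 1 ^ (n + 1) / (Real.exp 1 * √((n + 1 : ℕ) : ℝ)) := by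
    intro n
    have h := fact_upper n
    rw [ge_iff_le, div_le_div_iff₀ (by positivity) (by positivity)]
    calc Real.exp 1 ^ (n + 1) * ((n + 1).factorial : ℝ) ≤ Real.exp 1 ^ (n + 1) *
          (Real.exp 1 * √((n + 1 : ℕ) : ℝ) * (((n + 1 : ℕ) : ℝ) / Real.exp 1) ^ (n + 1)) := by
          gcongr
      _ = _ := by rw [div_pow]; field_simp
  have lo : ((a + b + 1 + 1 : ℕ) : ℝ) ^ (a + b + 1 + 1) / ((a + b + 1 + 1).factorial : ℝ)
      ≤ Real.exp 1 ^ (a + b + 1 + 1) / √(2 * Real.pi * ((a + b + 1 + 1 : ℕ) : ℝ)) := by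
    have h := Stirling.le_factorial_stirling (a + b + 1 + 1)
    rw [div_le_div_iff₀ (by positivity) (by positivity)]
    rw [div_pow, mul_div_assoc', div_le_iff₀ (by positivity)] at h
    linarith
  refine lo.trans (le_trans ?_ (mul_le_mul_of_nonneg_left
    (mul_le_mul (up a) (up b) (by positivity) (by positivity)) (by positivity)))
  have hm : √((a + 1 : ℕ) : ℝ) * √((b + 1 : ℕ) : ℝ) ≤
      √((min (a + 1) (b + 1) : ℕ) : ℝ) * √((a + b + 1 + 1 : ℕ) : ℝ) := by
    rw [← Real.sqrt_mul (by positivity), ← Real.sqrt_mul (by positivity)]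
    apply Real.sqrt_le_sqrt
    norm_cast
    rcases le_total (a + 1) (b + 1) with h | h
    · rw [min_eq_left h]; gcongr; omega
    · rw [min_eq_right h, mul_comm]; gcongr; omega
  have hpi : √(2 * Real.pi * ((a + b + 1 + 1 : ℕ) : ℝ)) =
      √(2 * Real.pi) * √((a + b + 1 + 1 : ℕ) : ℝ) := Real.sqrt_mul (by positivity) _
  have h2 : 2 ≤ √(2 * Real.pi) := by
    apply Real.le_sqrt_of_sq_le; nlinarith [Real.pi_gt_three]
  have h3 : Real.exp 1 ^ 2 ≤ 8 := by nlinarith [Real.exp_one_lt_d9]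
  rw [hpi]
  set A := √((a + 1 : ℕ) : ℝ)
  set B := √((b + 1 : ℕ) : ℝ)
  set M := √((min (a + 1) (b + 1) : ℕ) : ℝ)
  set N := √((a + b + 1 + 1 : ℕ) : ℝ)
  have hA : 0 < A := by positivity
  have hB : 0 < B := by positivity
  have hN : 0 < N := by positivity
  have hM : 0 ≤ M := by positivity
  have : 4 * M * (Real.exp 1 ^ (a + 1) / (Real.exp 1 * A) * (Real.exp 1 ^ (b + 1) / (Real.exp 1 * B)))
     = Real.exp 1 ^ (a + b + 1 + 1) * (4 * M / (Real.exp 1 ^ 2 * (A * B))) := by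
    field_simp; ring
  rw [this, div_eq_mul_inv]
  gcongr
  rw [inv_eq_one_div, div_le_div_iff₀ (by positivity) (by positivity)]
  calc 1 * (Real.exp 1 ^ 2 * (A * B)) ≤ 1 * (8 * (M * N)) := by gcongr
    _ = 4 * M * (2 * N) := by ring
    _ ≤ _ := by gcongr
lemma extz_sub {m : ℕ} (u v : Fin m → ℝ) (n : ℕ) : extz (u - v) n = extz u n - extz v n := by
  unfold extz; split_ifs <;> simp

lemma extz_add {m : ℕ} (u v : Fin m → ℝ) (n : ℕ) : extz (u + v) n = extz u n + extz v n := by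
  unfold extz; split_ifs <;> simp

lemma psum_sub {m : ℕ} (u v : Fin m → ℝ) (n : ℕ) : psum (u - v) n = psum u n - psum v n := by
  unfold psum; simp [extz_sub]

lemma psum_add {m : ℕ} (u v : Fin m → ℝ) (n : ℕ) : psum (u + v) n = psum u n + psum v n := by
  unfold psum; simp [extz_add, Finset.sum_add_distrib]

/-- The shift vector. -/
noncomputable def sh (a l : ℕ) (τ : ℝ) : Fin a → ℝ := fun i => if (i : ℕ) + l = a then τ else 0

lemma psum_sh (a l : ℕ) (τ : ℝ) (h1 : 1 ≤ l) (h2 : l ≤ a) (n : ℕ) :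
    psum (sh a l τ) n = if a - l < n then τ else 0 := by
  induction n with
  | zero => simp [psum_zero]
  | succ n ih =>
    rw [psum_succ, ih]
    have : extz (sh a l τ) n = if n = a - l then τ else 0 := by
      unfold extz sh
      by_cases h : n < a
      · rw [dif_pos h]
        exact if_congr (by simp only; omega) rfl rfl
      · rw [dif_neg h, if_neg (by omega)]
    rw [this]
    split_ifs <;> first | omega | simp

/-- Paths whose last step is at least `ρ / 2`. -/
def KL (a : ℕ) (ρ r : ℝ) : Set (Fin a → ℝ) :=
  KK a ρ r ∩ {u | psum u a ≤ ρ * ((a : ℝ) + 1) - ρ / 2}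

lemma KK_cover (a : ℕ) (ρ r : ℝ) (hρ1 : 1 / 4 ≤ ρ) (hr : 1 ≤ r) :
    KK a ρ r ⊆ ⋃ l ∈ Finset.range (⌊8 * r⌋₊ + 1), (fun u => u - sh a l (ρ / 2)) ⁻¹' KL a ρ r := by
  intro u hu
  obtain ⟨hu0, hus, hud⟩ := hu
  simp only [Set.mem_iUnion, Set.mem_preimage, exists_prop, Finset.mem_range]
  by_cases hc : psum u a ≤ ρ * ((a : ℝ) + 1) - ρ / 2
  · refine ⟨0, by omega, ?_⟩
    have : sh a 0 (ρ / 2) = 0 := by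
      ext i
      have := i.2
      simp [sh]; intro h; omega
    rw [this, sub_zero]
    exact ⟨⟨hu0, hus, hud⟩, hc⟩
  · push Not at hc
    have claim : ∀ m ≤ a, (∀ l', 1 ≤ l' → l' ≤ m → extz u (a - l') < ρ / 2) →
        ρ * ((a : ℝ) + 1) - (m + 1) * (ρ / 2) ≤ psum u (a - m) := by
      intro m
      induction m with
      | zero => intro _ _; simp; linarith
      | succ m ih =>
        intro hm hl
        have h1 := ih (by omega) (fun l' h1 h2 => hl l' h1 (by omega))
        have h2 := hl (m + 1) (by omega) le_rfl
        have h3 : a - m = (a - (m + 1)) + 1 := by omega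
        rw [h3, psum_succ] at h1
        push_cast
        linarith
    have hex : ∃ l, 1 ≤ l ∧ l ≤ a ∧ ρ / 2 ≤ extz u (a - l) := by
      by_contra hcon
      push Not at hcon
      have := claim a le_rfl hcon
      rw [Nat.sub_self, psum_zero] at this
      have h0 : (0 : ℝ) ≤ a := Nat.cast_nonneg a
      nlinarith
    classical
    obtain ⟨hl1, hl2, hl3⟩ := Nat.find_spec hex
    have hmin := fun m => Nat.find_min (H := hex) (m := m)
    set l := Nat.find hex
    have claim2 : ∀ m < l, (m + 1) * (ρ / 2) ≤ psum u (a - m) - ρ * ((a - m : ℕ) : ℝ) := by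
      intro m hm
      have := claim m (by omega) (fun l' h1 h2 => by
        by_contra hcon
        push Not at hcon
        exact hmin l' (by omega) ⟨h1, by omega, hcon⟩)
      rw [Nat.cast_sub (by omega)]
      linarith
    refine ⟨l, ?_, ?_⟩
    · have h1 := claim2 (l - 1) (by omega)
      have h2 := (abs_le.1 (hud (a - (l - 1)) (by omega))).2
      rw [Nat.cast_sub hl1] at h1
      push_cast at h1
      have h3 : (l : ℝ) ≤ 8 * r := by
        have : (1 : ℝ) ≤ l := by exact_mod_cast hl1
        nlinarith
      have := Nat.le_floor h3
      omega
    · have hP : ∀ n, psum (u - sh a l (ρ / 2)) n = psum u n - if a - l < n then ρ / 2 else 0 := by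
        intro n; rw [psum_sub, psum_sh a l _ hl1 hl2]
      have hlast : psum (u - sh a l (ρ / 2)) a ≤ ρ * ((a : ℝ) + 1) - ρ / 2 := by
        rw [hP, if_pos (by omega)]; linarith
      refine ⟨⟨?_, by linarith, ?_⟩, hlast⟩
      · intro i
        simp only [Pi.sub_apply, sh]
        split_ifs with h
        · have : a - l = i := by omega
          rw [this] at hl3
          simp [extz] at hl3
          linarith
        · simpa using hu0 i
      · intro n hn
        rw [hP]
        split_ifs with h
        · have h1 := claim2 (a - n) (by omega)
          have h2 : a - (a - n) = n := by omega
          rw [h2] at h1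
          have h3 := abs_le.1 (hud n hn)
          have h4 : (0 : ℝ) ≤ ((a - n : ℕ) : ℝ) := Nat.cast_nonneg _
          rw [abs_le]
          constructor
          · nlinarith
          · linarith
        · simpa using hud n hn

lemma KL_measurable (a : ℕ) (ρ r : ℝ) : MeasurableSet (KL a ρ r) :=
  (KK_measurable a ρ r).inter (isClosed_le (psum_continuous a) continuous_const).measurableSet

lemma volume_KK_le (a : ℕ) (ρ r : ℝ) (hρ1 : 1 / 4 ≤ ρ) (hr : 1 ≤ r) :
    volume (KK a ρ r) ≤ ENNReal.ofReal (9 * r) * volume (KL a ρ r) := by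
  refine (measure_mono (KK_cover a ρ r hρ1 hr)).trans ?_
  refine (measure_biUnion_finset_le _ _).trans ?_
  have : ∀ l ∈ Finset.range (⌊8 * r⌋₊ + 1),
      volume ((fun u => u - sh a l (ρ / 2)) ⁻¹' KL a ρ r) = volume (KL a ρ r) := fun l _ =>
    (measurePreserving_sub_right volume (sh a l (ρ / 2))).measure_preimage
      (KL_measurable a ρ r).nullMeasurableSet
  rw [Finset.sum_congr rfl this, Finset.sum_const, Finset.card_range, nsmul_eq_mul]
  gcongr
  rw [← ENNReal.ofReal_natCast]
  apply ENNReal.ofReal_le_ofReal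
  push_cast
  have := Nat.floor_le (show 0 ≤ 8 * r by linarith)
  linarith

lemma psum_vec (b : ℕ) (t : ℝ) (n : ℕ) (hn : n ≤ b) :
    psum (vec b t) n = if 0 < n then t else 0 := by
  induction n with
  | zero => simp [psum_zero]
  | succ n ih =>
    rw [psum_succ, ih (by omega)]
    have : extz (vec b t) n = if n = 0 then t else 0 := by
      unfold extz vec
      rw [dif_pos (by omega)]
    rw [this]
    split_ifs <;> first | omega | simp

lemma glue_mem (a b : ℕ) (ρ r : ℝ) (hρ1 : 1 / 4 ≤ ρ) (hρ2 : ρ ≤ 1) (hr : 1 ≤ r) :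
    KL a ρ r ×ˢ (Set.Icc 0 (ρ / 2) ×ˢ KK b ρ r) ⊆
      glue a b (ρ * ((a : ℝ) + 1)) ⁻¹' KK (a + (b + 1)) ρ r := by
  rintro ⟨u, t, w⟩ ⟨⟨⟨hu0, hus, hud⟩, hul⟩, ⟨ht0, ht1⟩, ⟨hw0, hws, hwd⟩⟩
  simp only at hu0 hus hud hul ht0 ht1 hw0 hws hwd
  rw [Set.mem_ofPred_eq] at hul
  rw [Set.mem_preimage]
  set c := ρ * ((a : ℝ) + 1) with hc
  set g := glue a b c (u, t, w) with hg
  have e1 : ∀ n < a, extz g n = extz u n := by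
    intro n hn
    unfold extz
    rw [dif_pos (by omega), dif_pos hn]
    exact Fin.append_left (u := u) (i := ⟨n, hn⟩) _
  have e2 : extz g a = c - psum u a - t := by
    unfold extz
    rw [dif_pos (by omega), psum_all]
    exact Fin.append_right (u := u) (i := (0 : Fin (b + 1))) _
  have e3 : ∀ n < b, extz g (a + 1 + n) = extz (w + vec b t) n := by
    intro n hn
    unfold extz
    rw [dif_pos (by omega), dif_pos hn]
    have h := Fin.append_right u
      (Fin.cons (c - (∑ i, u i) - t) (w + vec b t) : Fin (b + 1) → ℝ) (Fin.succ ⟨n, hn⟩)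
    rw [Fin.cons_succ] at h
    rw [← h]
    change Fin.append u _ _ = _
    congr 1
    ext
    simp; omega
  have p1 : ∀ n ≤ a, psum g n = psum u n := by
    intro n hn
    unfold psum
    exact Finset.sum_congr rfl fun i hi => e1 i (by rw [Finset.mem_range] at hi; omega)
  have p2 : psum g (a + 1) = c - t := by
    rw [psum_succ, p1 a le_rfl, e2]; ring
  have p3 : ∀ n ≤ b, psum g (a + 1 + n) = c - t + psum w n + if 0 < n then t else 0 := by
    intro n hn
    rw [← psum_vec b t n hn, add_assoc (c - t), ← psum_add]
    induction n with
    | zero => simp [p2, psum_zero]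
    | succ n ih =>
      change psum g (a + 1 + n + 1) = _
      rw [psum_succ, ih (by omega), psum_succ, e3 n (by omega)]
      ring
  refine ⟨?_, ?_, ?_⟩
  · intro i
    refine Fin.addCases (fun i => ?_) (fun i => ?_) i
    · rw [hg, glue, Fin.append_left]; exact hu0 i
    · rw [hg, glue, Fin.append_right]
      refine Fin.cases ?_ (fun i => ?_) i
      · rw [Fin.cons_zero]
        simp only
        rw [← psum_all]; linarith
      · rw [Fin.cons_succ]
        simp only [Pi.add_apply, vec]
        have := hw0 i
        split_ifs <;> linarith
  · have : a + (b + 1) = a + 1 + b := by ring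
    have h := p3 b le_rfl
    rw [← this] at h
    rw [h]
    push_cast
    split_ifs <;> linarith
  · intro n hn
    rcases Nat.lt_or_ge a n with h | h
    · obtain ⟨m, rfl⟩ : ∃ m, n = a + 1 + m := ⟨n - (a + 1), by omega⟩
      rw [p3 m (by omega)]
      have hm := hwd m (by omega)
      push_cast
      split_ifs with h0
      · convert hm using 2
        rw [hc]; ring
      · have : m = 0 := by omega
        subst this
        rw [psum_zero, abs_le]
        push_cast
        constructor <;> linarith
    · rw [p1 n h]; exact hud n h

lemma volume_glue (a b : ℕ) (ρ r : ℝ) (hρ1 : 1 / 4 ≤ ρ) (hρ2 : ρ ≤ 1) (hr : 1 ≤ r) :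
    volume (KL a ρ r) * (ENNReal.ofReal (ρ / 2) * volume (KK b ρ r)) ≤
      volume (KK (a + (b + 1)) ρ r) := by
  rw [← (mp_glue a b (ρ * ((a : ℝ) + 1))).measure_preimage
    (KK_measurable _ ρ r).nullMeasurableSet]
  refine le_trans (le_of_eq ?_) (measure_mono (glue_mem a b ρ r hρ1 hρ2 hr))
  rw [Measure.volume_eq_prod, Measure.prod_prod, Measure.volume_eq_prod, Measure.prod_prod,
    Real.volume_Icc, sub_zero]

theorem p_supermultiplicative (ρ r : ℝ) (hρ1 : 1 / 4 ≤ ρ) (hρ2 : ρ ≤ 1) (hr : 1 ≤ r)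
    (a b : ℕ) :
    p ρ r a * p ρ r b / ENNReal.ofReal (10 ^ 8 * r * Real.sqrt ((min (a + 1) (b + 1) : ℕ) : ℝ)) ≤
      p ρ r (a + b + 1) := by
  have hρ : 0 < ρ := by linarith
  have hr0 : 0 < r := by linarith
  have hfin : ∀ m, volume (KK m ρ r) ≤ ENNReal.ofReal ((ρ * ((m : ℝ) + 1)) ^ m / (m.factorial : ℝ)) := by
    intro m
    rw [← volume_SS m _ (by positivity)]
    refine measure_mono fun u hu => ⟨hu.1, ?_⟩
    rw [← psum_all]; exact hu.2.1
  have hne : ∀ m, volume (KK m ρ r) ≠ ⊤ := fun m => ((hfin m).trans_lt ENNReal.ofReal_lt_top).ne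
  have hneL : volume (KL a ρ r) ≠ ⊤ := ne_top_of_le_ne_top (hne a) (measure_mono Set.inter_subset_left)
  have hp : ∀ m, p ρ r m = ENNReal.ofReal ((volume (KK m ρ r)).toReal /
      ((ρ * ((m : ℝ) + 1)) ^ m / (m.factorial : ℝ))) := by
    intro m
    rw [p_eq ρ r hr0.le, volume_SS m _ (by positivity),
      ENNReal.ofReal_div_of_pos (x := (volume (KK m ρ r)).toReal) (show 0 < (ρ * ((m : ℝ) + 1)) ^ m / (m.factorial : ℝ) by positivity),
      ENNReal.ofReal_toReal (hne m), ← ENNReal.div_eq_inv_mul]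
  have hM : (0 : ℝ) < √((min (a + 1) (b + 1) : ℕ) : ℝ) := by
    apply Real.sqrt_pos.2
    exact_mod_cast (by omega)
  rw [hp a, hp b, hp (a + b + 1), ← ENNReal.ofReal_mul (by positivity),
    ← ENNReal.ofReal_div_of_pos (by positivity)]
  apply ENNReal.ofReal_le_ofReal
  have h1 := ENNReal.toReal_mono (ENNReal.mul_ne_top ENNReal.ofReal_ne_top hneL)
    (volume_KK_le a ρ r hρ1 hr)
  have h2 := ENNReal.toReal_mono (hne _) (volume_glue a b ρ r hρ1 hρ2 hr)
  rw [ENNReal.toReal_mul, ENNReal.toReal_ofReal (by positivity)] at h1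
  rw [ENNReal.toReal_mul, ENNReal.toReal_mul, ENNReal.toReal_ofReal (by positivity)] at h2
  change _ ≤ (volume (KK (a + (b + 1)) ρ r)).toReal / _
  have h3 := ratio_bound a b
  set A := (volume (KK a ρ r)).toReal
  set B := (volume (KK b ρ r)).toReal
  set L := (volume (KL a ρ r)).toReal
  set C := (volume (KK (a + (b + 1)) ρ r)).toReal
  set M := √((min (a + 1) (b + 1) : ℕ) : ℝ)
  have hA : 0 ≤ A := ENNReal.toReal_nonneg
  have hB : 0 ≤ B := ENNReal.toReal_nonneg
  have hL : 0 ≤ L := ENNReal.toReal_nonneg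
  have hC : A * B * ρ ≤ 18 * r * C := by
    have : A * B ≤ 9 * r * L * B := by gcongr
    calc A * B * ρ ≤ 9 * r * L * B * ρ := by gcongr
      _ = 18 * r * (L * (ρ / 2 * B)) := by ring
      _ ≤ _ := by gcongr
  have ea : ∀ m : ℕ, (ρ * ((m : ℝ) + 1)) ^ m / (m.factorial : ℝ)
      = ρ ^ m * (((m : ℝ) + 1) ^ m / (m.factorial : ℝ)) := by
    intro m; rw [mul_pow]; ring
  have en : (((a + b + 1 : ℕ) : ℝ) + 1) = (a + b + 2 : ℝ) := by push_cast; ring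
  rw [ea, ea, ea, en]
  set X := (a + 1 : ℝ) ^ a / (a.factorial : ℝ)
  set Y := (b + 1 : ℝ) ^ b / (b.factorial : ℝ)
  set Z := (a + b + 2 : ℝ) ^ (a + b + 1) / ((a + b + 1).factorial : ℝ)
  have hX : 0 < X := by positivity
  have hY : 0 < Y := by positivity
  have hZ : 0 < Z := by positivity
  have hC0 : 0 ≤ C := ENNReal.toReal_nonneg
  rw [div_mul_div_comm, div_div, div_le_div_iff₀ (by positivity) (by positivity)]
  calc A * B * (ρ ^ (a + b + 1) * Z) = ρ ^ a * ρ ^ b * ((A * B * ρ) * Z) := by ring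
    _ ≤ ρ ^ a * ρ ^ b * ((18 * r * C) * (4 * M * (X * Y))) := by gcongr
    _ = 72 * (ρ ^ a * ρ ^ b * (r * C * M * (X * Y))) := by ring
    _ ≤ 10 ^ 8 * (ρ ^ a * ρ ^ b * (r * C * M * (X * Y))) := by gcongr; norm_num
    _ = _ := by ring

end Paper
end

section
/- For every δ ∈ (0,1] and c ∈ (0,1] there exist a constant c₀ > 0 (depending only on δ and c) and an absolute constant C⁺ > 0 such that the following holds for all sufficiently large n. Set λ = e^{−1} − (log n)^{−2} and ℓ = ⌈c(log n)^3⌉. Then every γ ∈ Γ_ℓ satisfies P( λℓ − 1 ≤ X(γ) ≤ λℓ and M(γ) ≤ δ·log n ) ≥ c₀ · ℓ^{−1/2} · n^{−ℓ} · n^{−ec − cC⁺/δ²}. -/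
open MeasureTheory ProbabilityTheory Filter Finset

namespace Paper

noncomputable def Psi (N u : ℝ) : ℝ := 4 - 8 * u ^ 2 / N + 5 * u ^ 4 / N ^ 2 - u ^ 6 / N ^ 3

noncomputable def EPsi (N u : ℝ) : ℝ :=
  4 - 8 * (u ^ 2 + 1) / N + 5 * (u ^ 4 + 6 * u ^ 2 + 8 * u + 9) / N ^ 2
    - (u ^ 6 + 15 * u ^ 4 + 40 * u ^ 3 + 135 * u ^ 2 + 264 * u + 265) / N ^ 3

lemma Psi_factor {N : ℝ} (hN : 0 < N) (u : ℝ) :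
    Psi N u = (1 - u ^ 2 / N) * (2 - u ^ 2 / N) ^ 2 := by
  unfold Psi; field_simp; ring

lemma Psi_le {N : ℝ} (hN : 0 < N) (u : ℝ) : Psi N u ≤ 4 := by
  rw [Psi_factor hN]
  have h : 0 ≤ u ^ 2 / N := by positivity
  set w := u ^ 2 / N
  nlinarith [mul_nonneg h (sq_nonneg (w - 5/2)), h]

lemma Psi_nonpos {N : ℝ} (hN : 0 < N) {u : ℝ} (hu : N ≤ u ^ 2) : Psi N u ≤ 0 := by
  rw [Psi_factor hN]
  have h : 1 ≤ u ^ 2 / N := by rw [le_div_iff₀ hN]; linarith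
  nlinarith [mul_nonneg (sub_nonneg.2 h) (sq_nonneg (2 - u ^ 2 / N))]

lemma Psi_mono {N N' : ℝ} (hN : 0 < N) (hNN : N ≤ N') {u : ℝ} (hu : u ^ 2 ≤ N) :
    Psi N u ≤ Psi N' u := by
  have hN' : 0 < N' := by linarith
  rw [Psi_factor hN, Psi_factor hN']
  have h1 : u ^ 2 / N ≤ 1 := by rw [div_le_iff₀ hN]; linarith
  have h2 : u ^ 2 / N' ≤ u ^ 2 / N := by gcongr
  have h3 : 0 ≤ u ^ 2 / N' := by positivity
  set a := u ^ 2 / N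
  set b := u ^ 2 / N'
  gcongr ?_ * ?_
  · nlinarith
  · linarith
  · nlinarith

lemma poly_core (e w t : ℝ) (he : 0 < e) (he' : e ≤ 1 / 10000) (hw : 0 ≤ w) (hw1 : w ≤ 1)
    (ht : |t| ≤ 1 / 50) :
    (1 - 4 * e) * (4 - 8 * w + 5 * w ^ 2 - w ^ 3) ≤
      4 - 8 * (w * (1 + e) + e) + 5 * (w ^ 2 * (1 + e) ^ 2 + 6 * w * (1 + e) * e + 8 * t * e + 9 * e ^ 2)
      - (w ^ 3 * (1 + e) ^ 3 + 15 * w ^ 2 * (1 + e) ^ 2 * e + 40 * w * (1 + e) * t * e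
        + 135 * w * (1 + e) * e ^ 2 + 264 * t * e ^ 2 + 265 * e ^ 3) := by
  obtain ⟨t1, t2⟩ := abs_le.1 ht
  have main : 5 ≤ 8 - 10 * w + 15 * w ^ 2 - 7 * w ^ 3 := by
    nlinarith [mul_nonneg (sub_nonneg.2 hw1) (sq_nonneg (w - 1/2)), mul_nonneg hw (sq_nonneg (w - 1)), mul_nonneg hw (sub_nonneg.2 hw1), mul_nonneg (sub_nonneg.2 hw1) (sq_nonneg (w - 3/5))]
  have hw2 : w ^ 2 ≤ 1 := by nlinarith
  have hw3 : w ^ 3 ≤ 1 := by nlinarith [pow_nonneg hw 2]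
  have hw20 := pow_nonneg hw 2
  have hw30 := pow_nonneg hw 3
  have hwe : w * e ≤ 1 / 10000 := by nlinarith
  have hwe0 : 0 ≤ w * e := by positivity
  have e1 : w ^ 3 * e ≤ 1/10000 := by nlinarith
  have e2 : w ^ 3 * e ^ 2 ≤ 1/10000 := by nlinarith [mul_nonneg hw30 he.le]
  have e3 : w ^ 2 * e ≤ 1/10000 := by nlinarith
  have e4 : w ^ 2 * e ^ 2 ≤ 1/10000 := by nlinarith [mul_nonneg hw20 he.le]
  have e5 : w * e ^ 2 ≤ 1/10000 := by nlinarith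
  have e6 : t * e ≤ 1/10000 := by nlinarith
  have e7 : e ^ 2 ≤ 1/10000 := by nlinarith
  have hwt : w * (1 + e) * t ≤ 1/49 := by
    have : w * (1 + e) ≤ 1.0001 := by nlinarith
    have h0 : 0 ≤ w * (1 + e) := by positivity
    nlinarith
  have p1 : 0 ≤ w ^ 2 * e := by positivity
  have D : 0 ≤ (8 - 10 * w + 15 * w ^ 2 - 7 * w ^ 3) + 5 * (w ^ 2 * e) + 30 * (w * e) + 40 * t + 45 * e
     - 3 * (w ^ 3 * e) - w ^ 3 * e ^ 2 - 30 * (w ^ 2 * e) - 15 * (w ^ 2 * e ^ 2) - 40 * (w * (1 + e) * t)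
     - 135 * (w * e) - 135 * (w * e ^ 2) - 264 * (t * e) - 265 * e ^ 2 := by linarith
  have := mul_nonneg he.le D
  linarith [this]

lemma poly_ineq (M u : ℝ) (hM : 10000 ≤ M) (hu : u ^ 2 ≤ M + 1) :
    (1 - 4 / M) * Psi (M + 1) u ≤ EPsi M u := by
  have hM0 : 0 < M := by linarith
  have hM1 : 0 < M + 1 := by linarith
  have h := poly_core (1 / M) (u ^ 2 / (M + 1)) (u / M) (by positivity)
    (by gcongr) (by positivity) (by rw [div_le_one hM1]; exact hu)
    (by
      rw [abs_div, abs_of_pos hM0, div_le_iff₀ hM0]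
      apply abs_le_of_sq_le_sq _ (by positivity)
      nlinarith)
  convert h using 1
  · unfold Psi; field_simp
  · unfold EPsi; field_simp
    try ring

lemma poly_ineq' (M N u : ℝ) (hM : 10000 ≤ M) (hN : M ≤ N) (hN1 : N ≤ M + 1) (hu : u ^ 2 ≤ N) :
    (1 - 4 / M) * Psi N u ≤ EPsi M u := by
  refine le_trans ?_ (poly_ineq M u hM (by linarith))
  have : 0 ≤ 1 - 4 / M := by
    rw [sub_nonneg, div_le_one (by linarith)]; linarith
  exact mul_le_mul_of_nonneg_left (Psi_mono (by linarith) hN1 hu) this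

lemma mom_int (k : ℕ) : IntegrableOn (fun z : ℝ => Real.exp (-z) * z ^ k) (Set.Ioi 0) ∧
    ∫ z in Set.Ioi (0:ℝ), Real.exp (-z) * z ^ k = (k.factorial : ℝ) := by
  have h := Real.GammaIntegral_convergent (s := (k:ℝ) + 1) (by positivity)
  have h2 := Real.Gamma_eq_integral (s := (k:ℝ) + 1) (by positivity)
  rw [Real.Gamma_nat_eq_factorial] at h2
  simp only [add_sub_cancel_right, Real.rpow_natCast] at h h2
  exact ⟨h, h2.symm⟩

lemma EPsi_int (N u : ℝ) (hN : 0 < N) :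
    IntegrableOn (fun z : ℝ => Real.exp (-z) * Psi N (u + z - 1)) (Set.Ioi 0) ∧
    ∫ z in Set.Ioi (0:ℝ), Real.exp (-z) * Psi N (u + z - 1) = EPsi N u := by
  obtain ⟨v, rfl⟩ : ∃ v, u = v + 1 := ⟨u - 1, by ring⟩
  let c : ℕ → ℝ := fun i => match i with
    | 0 => 4-8*v^2/N+5*v^4/N^2-v^6/N^3
    | 1 => -16*v/N+20*v^3/N^2-6*v^5/N^3
    | 2 => -8/N+30*v^2/N^2-15*v^4/N^3
    | 3 => 20*v/N^2-20*v^3/N^3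
    | 4 => 5/N^2-15*v^2/N^3
    | 5 => -6*v/N^3
    | _ => -1/N^3
  have hf : (fun z : ℝ => Real.exp (-z) * Psi N (v + 1 + z - 1)) =
      fun z => ∑ i ∈ range 7, c i * (Real.exp (-z) * z ^ i) := by
    funext z
    simp only [Finset.sum_range_succ, Finset.sum_range_zero, c, Psi]
    field_simp
    ring
  rw [hf]
  constructor
  · exact integrable_finsetSum _ fun i _ => (mom_int i).1.const_mul _
  · rw [integral_finsetSum _ fun i _ => (mom_int i).1.const_mul _]
    simp only [integral_const_mul, (mom_int _).2]
    simp only [Finset.sum_range_succ, Finset.sum_range_zero, c, EPsi, Nat.factorial]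
    push_cast
    field_simp
    ring

noncomputable def Phi (N u : ℝ) : ℝ := max (Psi N u) 0

lemma Psi_cont (N : ℝ) : Continuous (Psi N) := by unfold Psi; fun_prop

lemma Phi_meas (N : ℝ) : Measurable (Phi N) :=
  ((Psi_cont N).max continuous_const).measurable

lemma exp_bdd_int (f : ℝ → ℝ) (hf : Measurable f) (C : ℝ) (h0 : ∀ x, 0 ≤ f x) (hC : ∀ x, f x ≤ C)
    (u : ℝ) : IntegrableOn (fun z : ℝ => Real.exp (-z) * f (u + z - 1)) (Set.Ioi 0) := by
  have h := (mom_int 0).1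
  simp only [pow_zero, mul_one] at h
  refine Integrable.mono' (h.mul_const C) ?_ ?_
  · exact Measurable.aestronglyMeasurable (by fun_prop)
  · refine Filter.Eventually.of_forall fun z => ?_
    rw [Real.norm_of_nonneg (mul_nonneg (Real.exp_pos _).le (h0 _))]
    exact mul_le_mul_of_nonneg_left (hC _) (Real.exp_pos _).le

lemma Phi_step (M N u : ℝ) (hM : 10000 ≤ M) (hN : M ≤ N) (hN1 : N ≤ M + 1) :
    (1 - 4 / M) * Phi N u ≤ ∫ z in Set.Ioi (0:ℝ), Real.exp (-z) * Phi M (u + z - 1) := by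
  have hM0 : 0 < M := by linarith
  have hN0 : 0 < N := by linarith
  rcases le_total (Psi N u) 0 with h | h
  · rw [Phi, max_eq_right h, mul_zero]
    exact setIntegral_nonneg measurableSet_Ioi fun z _ =>
      mul_nonneg (Real.exp_pos _).le (le_max_right _ _)
  rw [Phi, max_eq_left h]
  rcases le_or_gt (u ^ 2) N with hu | hu
  · refine (poly_ineq' M N u hM hN hN1 hu).trans ?_
    rw [← (EPsi_int M u hM0).2]
    refine integral_mono (EPsi_int M u hM0).1
      (exp_bdd_int (Phi M) (Phi_meas M) 4 (fun _ => le_max_right _ _)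
        (fun x => max_le (Psi_le hM0 x) (by norm_num)) u) fun z => ?_
    exact mul_le_mul_of_nonneg_left (le_max_left _ _) (Real.exp_pos _).le
  · have : Psi N u = 0 := le_antisymm (Psi_nonpos hN0 hu.le) h
    rw [this, mul_zero]
    exact setIntegral_nonneg measurableSet_Ioi fun z _ =>
      mul_nonneg (Real.exp_pos _).le (le_max_right _ _)


lemma lint_step (r lam B s C : ℝ) (hr : 0 < r) (hl : 0 < lam) (hB : 0 ≤ B) (f : ℝ → ℝ)
    (hf : Measurable f) (h0 : ∀ x, 0 ≤ f x) (hC : ∀ x, f x ≤ C) :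
    ENNReal.ofReal (B * (r * lam * Real.exp (1 - r * lam)) * Real.exp ((r - 1 / lam) * s) *
        ∫ z in Set.Ioi (0:ℝ), Real.exp (-z) * f (s / lam + z - 1)) ≤
      ∫⁻ y, ENNReal.ofReal (B * Real.exp ((r - 1 / lam) * (s + y - lam)) * f ((s + y - lam) / lam))
        ∂(expMeasure r) := by
  set h : ℝ → ℝ := fun z => Real.exp (-z) * f (s / lam + z - 1) with hh
  have hIntg : IntegrableOn h (Set.Ioi 0) := exp_bdd_int f hf C h0 hC (s / lam)
  have hIntg2 : IntegrableOn (fun y => h (lam⁻¹ * y)) (Set.Ioi 0) := by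
    rw [integrableOn_Ioi_comp_mul_left_iff h 0 (inv_pos.2 hl)]
    simpa using hIntg
  have hval : ∫ y in Set.Ioi (0:ℝ), h (lam⁻¹ * y) = lam * ∫ z in Set.Ioi (0:ℝ), h z := by
    rw [integral_comp_mul_left_Ioi h 0 (inv_pos.2 hl)]
    simp
  set K : ℝ := B * Real.exp ((r - 1 / lam) * s) * r * Real.exp (1 - r * lam) with hK
  have hK0 : 0 ≤ K := by positivity
  have hF : ∀ y ∈ Set.Ioi (0:ℝ), exponentialPDF r y *
      ENNReal.ofReal (B * Real.exp ((r - 1 / lam) * (s + y - lam)) * f ((s + y - lam) / lam)) =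
      ENNReal.ofReal (K * h (lam⁻¹ * y)) := by
    intro y hy
    rw [exponentialPDF_of_nonneg (le_of_lt hy), ← ENNReal.ofReal_mul (by positivity)]
    congr 1
    have e1 : (s + y - lam) / lam = s / lam + lam⁻¹ * y - 1 := by field_simp
    rw [hK, hh]
    simp only
    rw [e1]
    have e2 : Real.exp (-(r * y)) * Real.exp ((r - 1 / lam) * (s + y - lam)) =
      Real.exp ((r - 1 / lam) * s) * Real.exp (1 - r * lam) * Real.exp (-(lam⁻¹ * y)) := by
      rw [← Real.exp_add, ← Real.exp_add, ← Real.exp_add]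
      congr 1
      field_simp
      ring
    linear_combination (r * B * f (s / lam + lam⁻¹ * y - 1)) * e2
  have hm : Measurable (exponentialPDF r) := (measurable_exponentialPDFReal r).ennreal_ofReal
  have hg : Measurable fun y => ENNReal.ofReal
      (B * Real.exp ((r - 1 / lam) * (s + y - lam)) * f ((s + y - lam) / lam)) := by fun_prop
  have hexp : expMeasure r = volume.withDensity (exponentialPDF r) := rfl
  rw [hexp, lintegral_withDensity_eq_lintegral_mul _ hm hg]
  refine le_trans ?_ (setLIntegral_le_lintegral (Set.Ioi 0) _)
  simp only [Pi.mul_apply]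
  rw [setLIntegral_congr_fun measurableSet_Ioi hF,
    ← ofReal_integral_eq_lintegral_ofReal (hIntg2.const_mul K)
      (Filter.Eventually.of_forall fun y =>
        mul_nonneg hK0 (mul_nonneg (Real.exp_pos _).le (h0 _))),
    integral_const_mul, hval]
  apply ENNReal.ofReal_le_ofReal
  apply le_of_eq
  rw [hK]; ring

/-- Tube event: starting from `s`, the walk with steps `y i - lam` stays in `[-T,T]` and ends in
`[-lam,0]`. -/
def Ev (lam T : ℝ) : ∀ k : ℕ, ℝ → Set (Fin k → ℝ)
  | 0, s => {_y | -lam ≤ s ∧ s ≤ 0}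
  | k + 1, s => {y | |s| ≤ T ∧ Fin.tail y ∈ Ev lam T k (s + y 0 - lam)}

lemma Ev_meas (lam T : ℝ) (k : ℕ) :
    MeasurableSet {p : ℝ × (Fin k → ℝ) | p.2 ∈ Ev lam T k p.1} := by
  induction k with
  | zero =>
    simp only [Ev, Set.mem_ofPred_eq]
    exact (measurableSet_le measurable_const measurable_fst).inter
      (measurableSet_le measurable_fst measurable_const)
  | succ k ih =>
    simp only [Ev, Set.mem_ofPred_eq]
    have h1 : Measurable fun p : ℝ × (Fin (k+1) → ℝ) => |p.1| := measurable_fst.abs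
    refine (measurableSet_le h1 measurable_const).inter ?_
    have hm : Measurable fun p : ℝ × (Fin (k+1) → ℝ) => (p.1 + p.2 0 - lam, Fin.tail p.2) := by
      refine Measurable.prodMk (by fun_prop) ?_
      refine measurable_pi_lambda _ fun i => ?_
      simp only [Fin.tail]
      fun_prop
    exact hm ih

/-- `Good` : lower bound for the probability of the tube event. -/
def Good (r lam T B : ℝ) (k : ℕ) (f : ℝ → ℝ) : Prop :=
  ∀ s : ℝ, ENNReal.ofReal (B * (r * lam * Real.exp (1 - r * lam)) ^ k *
    Real.exp ((r - 1 / lam) * s) * f (s / lam)) ≤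
    Measure.pi (fun _ : Fin k => expMeasure r) (Ev lam T k s)

lemma Good.mono {r lam T B : ℝ} {k : ℕ} {f g : ℝ → ℝ} (hr : 0 < r) (hl : 0 < lam) (hB : 0 ≤ B)
    (h : Good r lam T B k f) (hg : ∀ x, g x ≤ f x) : Good r lam T B k g := by
  intro s
  refine le_trans (ENNReal.ofReal_le_ofReal ?_) (h s)
  exact mul_le_mul_of_nonneg_left (hg _) (by positivity)

lemma Good.step {r lam T B C : ℝ} {k : ℕ} {f g : ℝ → ℝ} (hr : 0 < r) (hl : 0 < lam) (hB : 0 ≤ B)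
    (h : Good r lam T B k f)
    (hf : Measurable f) (h0 : ∀ x, 0 ≤ f x) (hC : ∀ x, f x ≤ C)
    (hg : ∀ u, g u ≤ ∫ z in Set.Ioi (0:ℝ), Real.exp (-z) * f (u + z - 1))
    (hsupp : ∀ u, T / lam < |u| → g u ≤ 0) : Good r lam T B (k + 1) g := by
  intro s
  have hprob : IsProbabilityMeasure (expMeasure r) := isProbabilityMeasure_expMeasure hr
  set A := r * lam * Real.exp (1 - r * lam) with hA
  have hA0 : 0 ≤ A := by positivity
  rcases lt_or_ge T |s| with hs | hs
  · have : g (s / lam) ≤ 0 := by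
      apply hsupp
      rw [abs_div, abs_of_pos hl]
      gcongr
    rw [ENNReal.ofReal_of_nonpos]
    · exact zero_le
    · exact mul_nonpos_of_nonneg_of_nonpos (by positivity) this
  calc _ ≤ ENNReal.ofReal ((B * A ^ k) * A * Real.exp ((r - 1 / lam) * s) *
        ∫ z in Set.Ioi (0:ℝ), Real.exp (-z) * f (s / lam + z - 1)) := by
        apply ENNReal.ofReal_le_ofReal
        rw [pow_succ, ← mul_assoc]
        exact mul_le_mul_of_nonneg_left (hg _) (by positivity)
    _ ≤ _ := lint_step r lam (B * A ^ k) s C hr hl (by positivity) f hf h0 hC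
    _ ≤ ∫⁻ y, Measure.pi (fun _ : Fin k => expMeasure r) (Ev lam T k (s + y - lam))
        ∂(expMeasure r) := lintegral_mono fun y => h (s + y - lam)
    _ = (expMeasure r).prod (Measure.pi (fun _ : Fin k => expMeasure r))
          {p | p.2 ∈ Ev lam T k (s + p.1 - lam)} := by
        rw [Measure.prod_apply]
        · rfl
        · have hm : Measurable fun p : ℝ × (Fin k → ℝ) => (s + p.1 - lam, p.2) := by fun_prop
          exact hm (Ev_meas lam T k)
    _ = Measure.pi (fun _ : Fin (k+1) => expMeasure r) (Ev lam T (k+1) s) := by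
        have hmp := measurePreserving_piFinSuccAbove (fun _ : Fin (k+1) => expMeasure r) 0
        rw [← hmp.measure_preimage_equiv]
        congr 1
        ext y
        simp only [Ev, Set.mem_preimage, Set.mem_ofPred_eq, hs, true_and]
        rfl

lemma Good.zero {r lam T : ℝ} (hr : 0 < r) (hl : 0 < lam) :
    Good r lam T (Real.exp (-1)) 0 (Set.indicator (Set.Icc (-1) 0) fun _ => 1) := by
  intro s
  by_cases hs : s / lam ∈ Set.Icc (-1:ℝ) 0
  · obtain ⟨h1, h2⟩ := hs
    have h1' : -lam ≤ s := by rw [le_div_iff₀ hl] at h1; linarith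
    have h2' : s ≤ 0 := by rw [div_le_iff₀ hl] at h2; linarith
    have : Ev lam T 0 s = Set.univ := by
      ext y; simp [Ev, h1', h2']
    have hprob : IsProbabilityMeasure (expMeasure r) := isProbabilityMeasure_expMeasure hr
    rw [this, measure_univ, Set.indicator_of_mem (Set.mem_Icc.2 ⟨h1, h2⟩), pow_zero, mul_one, mul_one,
      ← Real.exp_add, ENNReal.ofReal_le_one, Real.exp_le_one_iff]
    have : (r - 1 / lam) * s = r * s - s / lam := by ring
    rw [this]
    nlinarith
  · rw [Set.indicator_of_notMem hs]
    simp

lemma Ev_spec (lam T : ℝ) (k : ℕ) (s : ℝ) (y : Fin k → ℝ) (hl : lam ≤ T) (hl0 : 0 ≤ lam)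
    (h : y ∈ Ev lam T k s) :
    (-lam ≤ s + (∑ i, y i) - k * lam ∧ s + (∑ i, y i) - k * lam ≤ 0) ∧
    ∀ j ≤ k, |s + (∑ i : Fin k, if (i : ℕ) < j then y i else 0) - j * lam| ≤ T := by
  induction k generalizing s with
  | zero =>
    simp only [Ev, Set.mem_ofPred_eq] at h
    refine ⟨by simpa using h, fun j hj => ?_⟩
    obtain rfl : j = 0 := by omega
    simp only [univ_eq_empty, sum_empty, add_zero, CharP.cast_eq_zero, zero_mul, sub_zero]
    rw [abs_le]; constructor <;> linarith [h.1, h.2]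
  | succ k ih =>
    obtain ⟨h1, h2⟩ := h
    obtain ⟨⟨h3, h4⟩, h5⟩ := ih _ _ h2
    simp only [Fin.tail] at h3 h4 h5
    refine ⟨?_, fun j hj => ?_⟩
    · rw [Fin.sum_univ_succ]; push_cast
      constructor <;> linarith
    · rcases j with _ | j
      · simpa using h1
      · have := h5 j (by omega)
        rw [Fin.sum_univ_succ]
        simp only [Fin.val_succ, add_lt_add_iff_right, Fin.val_zero, Nat.zero_lt_succ, if_true]
        push_cast
        convert this using 2
        ring

lemma edge_inj {n ℓ : ℕ} (v : Fin (ℓ + 1) → Fin n) (hv : Function.Injective v) :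
    Function.Injective fun i : Fin ℓ => s(v i.castSucc, v i.succ) := by
  intro i j hij
  simp only [Sym2.eq_iff] at hij
  rcases hij with ⟨h, _⟩ | ⟨h1, h2⟩
  · exact Fin.castSucc_injective _ (hv h)
  · have h1 := congrArg Fin.val (hv h1)
    have h2 := congrArg Fin.val (hv h2)
    simp at h1 h2
    omega

lemma law_path {ι : Type*} [Fintype ι] {ℓ : ℕ} (r : ℝ) (hr : 0 < r) (g : Fin ℓ → ι)
    (hg : Function.Injective g) :
    MeasurePreserving (fun (ω : ι → ℝ) (i : Fin ℓ) => ω (g i))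
      (Measure.pi fun _ => expMeasure r) (Measure.pi fun _ => expMeasure r) := by
  have hprob : IsProbabilityMeasure (expMeasure r) := isProbabilityMeasure_expMeasure hr
  refine ⟨by fun_prop, ?_⟩
  have h := iIndepFun_pi (μ := fun _ : ι => expMeasure r) (X := fun _ x => x)
    (fun i => aemeasurable_id)
  have h2 := (iIndepFun_iff_map_fun_eq_pi_map (fun i => (measurable_pi_apply (g i)).aemeasurable)).1 (h.precomp hg)
  rw [h2]
  congr 1
  ext1 i
  exact (measurePreserving_eval (fun _ : ι => expMeasure r) (g i)).map_eq


lemma ind_step (R u a k : ℝ) (ha : 0 ≤ a) (haR : a ≤ 1 / 2 + R)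
    (h : ∀ z ∈ Set.Ioc a (a + 1 / 2), u + z - 1 ∈ Set.Icc (-1) k) :
    1 / 2 * Real.exp (-(1 + R)) ≤ ∫ z in Set.Ioi (0:ℝ), Real.exp (-z) *
      (Set.indicator (Set.Icc (-1) k) (fun _ => (1:ℝ)) (u + z - 1)) := by
  have hm : Measurable (Set.indicator (Set.Icc (-1) k) (fun _ => (1:ℝ))) :=
    measurable_const.indicator measurableSet_Icc
  have h0 : ∀ x, 0 ≤ Set.indicator (Set.Icc (-1) k) (fun _ => (1:ℝ)) x := fun x =>
    Set.indicator_nonneg (fun _ _ => zero_le_one) x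
  have hIntg := exp_bdd_int _ hm 1 h0
    (fun x => Set.indicator_le_self' (s := Set.Icc (-1) k) (fun _ _ => zero_le_one) x) u
  have hsub : Set.Ioc a (a + 1 / 2) ⊆ Set.Ioi 0 := fun z hz => lt_of_le_of_lt ha hz.1
  calc 1 / 2 * Real.exp (-(1 + R)) = ∫ z in Set.Ioc a (a + 1 / 2), Real.exp (-(1 + R)) := by
        rw [setIntegral_const]
        simp
    _ ≤ ∫ z in Set.Ioc a (a + 1 / 2), Real.exp (-z) *
      (Set.indicator (Set.Icc (-1) k) (fun _ => (1:ℝ)) (u + z - 1)) := by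
        refine setIntegral_mono_on ?_ (hIntg.mono_set hsub) measurableSet_Ioc fun z hz => ?_
        · exact integrableOn_const (by simp)
        · rw [Set.indicator_of_mem (h z hz), mul_one]
          apply Real.exp_le_exp.2
          linarith [hz.2]
    _ ≤ _ := by
        refine setIntegral_mono_set hIntg ?_ hsub.eventuallyLE
        exact Filter.Eventually.of_forall fun z => mul_nonneg (Real.exp_pos _).le (h0 _)

lemma ind_step' (R u : ℝ) (k : ℕ) (hR : 0 ≤ R) (h1 : -R ≤ u) (h2 : u ≤ ((k + 1 : ℕ) : ℝ) / 4) :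
    1 / 2 * Real.exp (-(1 + R)) ≤ ∫ z in Set.Ioi (0:ℝ), Real.exp (-z) *
      (Set.indicator (Set.Icc (-1) ((k : ℝ) / 4)) (fun _ => (1:ℝ)) (u + z - 1)) := by
  push_cast at h2
  have hk : (0:ℝ) ≤ k := Nat.cast_nonneg k
  rcases le_total u 0 with hu | hu
  · refine ind_step R u (1 / 2 - u) _ (by linarith) (by linarith) fun z hz => ?_
    constructor
    · linarith [hz.1]
    · linarith [hz.2]
  · refine ind_step R u 0 _ le_rfl (by linarith) fun z hz => ?_
    constructor
    · linarith [hz.1]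
    · linarith [hz.2]

noncomputable def kap (R : ℝ) : ℝ := 1 / 2 * Real.exp (-(1 + R))

lemma kap_pos (R : ℝ) : 0 < kap R := by unfold kap; positivity

lemma init_good (r lam D R : ℝ) (hr : 0 < r) (hl : 0 < lam) (hR : 1 ≤ R) (hD : R ≤ D) (k : ℕ)
    (hk : (k : ℝ) ≤ 4 * R) :
    Good r lam (lam * D) (Real.exp (-1)) k
      (fun u => kap R ^ k * Set.indicator (Set.Icc (-1) ((k : ℝ) / 4)) (fun _ => (1:ℝ)) u) ∧
    (0 < k → Good r lam (lam * D) (Real.exp (-1)) k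
      (fun u => kap R ^ k * Set.indicator (Set.Icc (-R) ((k : ℝ) / 4)) (fun _ => (1:ℝ)) u)) := by
  have hTD : lam * D / lam = D := by field_simp
  have hkp := kap_pos R
  induction k with
  | zero =>
    refine ⟨?_, fun h => absurd h (lt_irrefl _)⟩
    simpa using Good.zero (T := lam * D) hr hl
  | succ k ih =>
    have hk' : (k : ℝ) + 1 ≤ 4 * R := by push_cast at hk; exact hk
    have ih := (ih (by linarith)).1
    have key : Good r lam (lam * D) (Real.exp (-1)) (k + 1)
      (fun u => kap R ^ (k + 1) * Set.indicator (Set.Icc (-R) (((k + 1 : ℕ) : ℝ) / 4))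
        (fun _ => (1:ℝ)) u) := by
      refine Good.step (C := kap R ^ k) hr hl (Real.exp_pos _).le ih ?_ ?_ ?_ ?_ ?_
      · exact (measurable_const.indicator measurableSet_Icc).const_mul _
      · intro x
        exact mul_nonneg (by positivity) (Set.indicator_nonneg (fun _ _ => zero_le_one) x)
      · intro x
        refine mul_le_of_le_one_right (by positivity) ?_
        exact Set.indicator_le_self' (s := Set.Icc (-1) ((k:ℝ)/4)) (fun _ _ => zero_le_one) x
      · intro u
        have e : (fun z : ℝ => Real.exp (-z) * (kap R ^ k *
            Set.indicator (Set.Icc (-1) ((k:ℝ)/4)) (fun _ => (1:ℝ)) (u + z - 1))) =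
            fun z => kap R ^ k * (Real.exp (-z) *
            Set.indicator (Set.Icc (-1) ((k:ℝ)/4)) (fun _ => (1:ℝ)) (u + z - 1)) := by
          funext z; ring
        rw [e, integral_const_mul, pow_succ, mul_assoc]
        refine mul_le_mul_of_nonneg_left ?_ (by positivity)
        by_cases hu : u ∈ Set.Icc (-R) (((k + 1 : ℕ) : ℝ) / 4)
        · rw [Set.indicator_of_mem hu, mul_one]
          exact ind_step' R u k (by linarith) hu.1 hu.2
        · rw [Set.indicator_of_notMem hu, mul_zero]
          exact setIntegral_nonneg measurableSet_Ioi fun z _ =>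
            mul_nonneg (Real.exp_pos _).le (Set.indicator_nonneg (fun _ _ => zero_le_one) _)
      · intro u hu
        rw [hTD] at hu
        rw [Set.indicator_of_notMem, mul_zero]
        rintro ⟨a, b⟩
        push_cast at b
        have : |u| ≤ D := abs_le.2 ⟨by linarith, by linarith⟩
        linarith
    refine ⟨?_, fun _ => key⟩
    refine key.mono hr hl (Real.exp_pos _).le fun u => ?_
    refine mul_le_mul_of_nonneg_left ?_ (by positivity)
    exact Set.indicator_le_indicator_of_subset (Set.Icc_subset_Icc_left (by linarith))
      (fun _ => zero_le_one) u

noncomputable def Nn (D : ℝ) (j : ℕ) : ℝ := min (10000 + (j : ℝ)) (D ^ 2)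

noncomputable def gg (D : ℝ) (j : ℕ) : ℝ := ∏ i ∈ range j, (1 - 4 / Nn D i)

lemma Nn_ge {D : ℝ} (hD : 100 ≤ D) (j : ℕ) : 10000 ≤ Nn D j := by
  refine le_min ?_ (by nlinarith)
  have : (0:ℝ) ≤ j := Nat.cast_nonneg j
  linarith

lemma gg_nonneg {D : ℝ} (hD : 100 ≤ D) (j : ℕ) : 0 ≤ gg D j := by
  refine Finset.prod_nonneg fun i _ => ?_
  have := Nn_ge hD i
  rw [sub_nonneg, div_le_one (by linarith)]; linarith

lemma main_good (r lam D : ℝ) (hr : 0 < r) (hl : 0 < lam) (hD : 100 ≤ D) (K : ℕ) (hK : K = 400)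
    (j : ℕ) :
    Good r lam (lam * D) (Real.exp (-1)) (K + j)
      (fun u => (kap 100 ^ K / 4 * gg D j) * Phi (Nn D j) u) := by
  have hTD : lam * D / lam = D := by field_simp
  have hkp := kap_pos 100
  have hKr : (K : ℝ) = 400 := by rw [hK]; norm_num
  induction j with
  | zero =>
    have h := (init_good r lam D 100 hr hl (by norm_num) hD K (by rw [hKr]; norm_num)).2
      (by omega)
    refine h.mono hr hl (Real.exp_pos _).le fun u => ?_
    have hN0 : 0 < Nn D 0 := by linarith [Nn_ge hD 0]
    have hN : Nn D 0 ≤ 10000 := by unfold Nn; exact (min_le_left _ _).trans (by simp)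
    have hg : gg D 0 = 1 := by simp [gg]
    rw [hg, mul_one, div_mul_eq_mul_div, mul_div_assoc]
    refine mul_le_mul_of_nonneg_left ?_ (by positivity)
    by_cases hu : u ∈ Set.Icc (-100) ((K:ℝ) / 4)
    · rw [Set.indicator_of_mem hu]
      have : Phi (Nn D 0) u ≤ 4 := max_le (Psi_le hN0 u) (by norm_num)
      linarith
    · rw [Set.indicator_of_notMem hu]
      have : Psi (Nn D 0) u ≤ 0 := by
        apply Psi_nonpos hN0
        rw [hKr] at hu
        by_contra hc
        apply hu
        have h2 := abs_le_of_sq_le_sq' (a := u) (b := 100) (by linarith) (by norm_num)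
        exact ⟨h2.1, by linarith [h2.2]⟩
      rw [Phi, max_eq_right this, zero_div]
  | succ j ih =>
    have hM := Nn_ge hD j
    have hM1 := Nn_ge hD (j + 1)
    have hg0 := gg_nonneg hD j
    have hc : 0 ≤ kap 100 ^ K / 4 * gg D j := by positivity
    refine Good.step (C := kap 100 ^ K / 4 * gg D j * 4) hr hl (Real.exp_pos _).le ih ?_ ?_ ?_ ?_ ?_
    · exact (Phi_meas _).const_mul _
    · exact fun x => mul_nonneg hc (le_max_right _ _)
    · exact fun x => mul_le_mul_of_nonneg_left
        (max_le (Psi_le (by linarith) x) (by norm_num)) hc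
    · intro u
      have e : (fun z : ℝ => Real.exp (-z) * (kap 100 ^ K / 4 * gg D j * Phi (Nn D j) (u + z - 1))) =
          fun z => (kap 100 ^ K / 4 * gg D j) * (Real.exp (-z) * Phi (Nn D j) (u + z - 1)) := by
        funext z; ring
      rw [e, integral_const_mul]
      have e2 : gg D (j + 1) = gg D j * (1 - 4 / Nn D j) := by
        unfold gg; rw [Finset.prod_range_succ]
      rw [e2, ← mul_assoc, mul_assoc (kap 100 ^ K / 4 * gg D j)]
      refine mul_le_mul_of_nonneg_left ?_ hc
      apply Phi_step _ _ _ hM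
      · unfold Nn; push_cast; exact min_le_min_right _ (by linarith)
      · unfold Nn; push_cast
        rw [← min_add_add_right]
        exact min_le_min (by linarith) (by linarith)
    · intro u hu
      rw [hTD] at hu
      have : Psi (Nn D (j + 1)) u ≤ 0 := by
        apply Psi_nonpos (by linarith)
        refine (min_le_right _ _).trans ?_
        rw [← sq_abs u]
        exact pow_le_pow_left₀ (by linarith) hu.le 2
      rw [Phi, max_eq_right this, mul_zero]

lemma exp_le_one_sub {x : ℝ} (h0 : 0 ≤ x) (h1 : x ≤ 1 / 2) : Real.exp (-(2 * x)) ≤ 1 - x := by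
  rw [Real.exp_neg]
  have h := Real.add_one_le_exp (2 * x)
  rw [inv_le_comm₀ (Real.exp_pos _) (by linarith)]
  refine le_trans ?_ h
  rw [inv_le_iff_one_le_mul₀ (by linarith)]
  nlinarith

lemma gg_lower {D : ℝ} (hD : 100 ≤ D) (j ℓ : ℕ) (hj : j ≤ ℓ) :
    Real.exp (-(8 * (1 + Real.log ℓ) + 8 * ℓ / D ^ 2)) ≤ gg D j := by
  have h1 : ∀ i ∈ range j, Real.exp (-(8 / ((i : ℝ) + 1) + 8 / D ^ 2)) ≤ 1 - 4 / Nn D i := by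
    intro i _
    have hN := Nn_ge hD i
    have hi : (0:ℝ) ≤ i := Nat.cast_nonneg i
    refine le_trans ?_ (exp_le_one_sub (x := 4 / Nn D i) (by positivity)
      (by rw [div_le_iff₀ (by linarith)]; linarith))
    apply Real.exp_le_exp.2
    have hD2 : 0 ≤ 8 / D ^ 2 := by positivity
    have hi2 : 0 ≤ 8 / ((i:ℝ) + 1) := by positivity
    have e : 2 * (4 / Nn D i) = 8 / Nn D i := by ring
    rw [e]
    apply neg_le_neg
    unfold Nn
    rcases min_choice (10000 + (i:ℝ)) (D ^ 2) with h | h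
    · rw [h]
      have : 8 / (10000 + (i:ℝ)) ≤ 8 / ((i:ℝ) + 1) :=
        div_le_div_of_nonneg_left (by norm_num) (by positivity) (by linarith)
      linarith
    · rw [h]; linarith
  refine le_trans ?_ (Finset.prod_le_prod (fun i _ => (Real.exp_pos _).le) h1)
  rw [← Real.exp_sum]
  apply Real.exp_le_exp.2
  rw [Finset.sum_neg_distrib, neg_le_neg_iff, Finset.sum_add_distrib, Finset.sum_const, card_range,
    nsmul_eq_mul]
  have hjl : (j : ℝ) ≤ ℓ := by exact_mod_cast hj
  have hh : ∑ i ∈ range j, 8 / ((i:ℝ) + 1) ≤ 8 * (1 + Real.log ℓ) := by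
    have h2 := harmonic_le_one_add_log ℓ
    have h3 : ((harmonic ℓ : ℚ) : ℝ) = ∑ i ∈ range ℓ, ((i:ℝ) + 1)⁻¹ := by
      simp [harmonic]
    rw [h3] at h2
    have h4 : ∑ i ∈ range j, 8 / ((i:ℝ) + 1) ≤ ∑ i ∈ range ℓ, 8 / ((i:ℝ) + 1) := by
      apply Finset.sum_le_sum_of_subset_of_nonneg (Finset.range_mono hj)
      intro i _ _; positivity
    refine h4.trans ?_
    simp only [div_eq_mul_inv, ← Finset.mul_sum]
    linarith
  have : (j:ℝ) * (8 / D ^ 2) ≤ 8 * ℓ / D ^ 2 := by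
    rw [mul_comm (8:ℝ), mul_div_assoc]
    gcongr
  linarith

lemma core_s18 (r lam D : ℝ) (hr : 0 < r) (hl : 0 < lam) (hD : 100 ≤ D) (K : ℕ) (hK : K = 400)
    (ℓ : ℕ) (hℓ : K ≤ ℓ) :
    ENNReal.ofReal (Real.exp (-1) * (r * lam * Real.exp (1 - r * lam)) ^ ℓ *
      (kap 100 ^ K * Real.exp (-(8 * (1 + Real.log ℓ) + 8 * ℓ / D ^ 2)))) ≤
    Measure.pi (fun _ : Fin ℓ => expMeasure r) (Ev lam (lam * D) ℓ 0) := by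
  obtain ⟨j, rfl⟩ := Nat.exists_eq_add_of_le hℓ
  refine le_trans (ENNReal.ofReal_le_ofReal ?_) (main_good r lam D hr hl hD K hK j 0)
  have hkp := kap_pos 100
  have hN0 : 0 < Nn D j := by linarith [Nn_ge hD j]
  have hP : Phi (Nn D j) (0 / lam) = 4 := by
    simp [Phi, Psi]
  beta_reduce
  rw [hP]
  have := gg_lower hD j (K + j) (by omega)
  have e : kap 100 ^ K / 4 * gg D j * 4 = kap 100 ^ K * gg D j := by ring
  rw [e, mul_zero, Real.exp_zero, mul_one]
  gcongr

lemma numeric (δ c L : ℝ) (n ℓ K : ℕ) (hδ : 0 < δ) (hδ1 : δ ≤ 1) (hc : 0 < c)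
    (hn : (n : ℝ) = Real.exp L) (hL10 : 10 ≤ L)
    (hℓ : (ℓ : ℝ) ≤ 2 * c * L ^ 3) (hℓ1 : (1:ℝ) ≤ ℓ) (hlog : 8 * Real.log ℓ ≤ c * L) (lam : ℝ)
    (hlam : lam = Real.exp (-1) - (L ^ 2)⁻¹) (hl0 : 0 < lam) (hl1 : lam ≤ 1 / 2) :
    (Real.exp (-1) * kap 100 ^ K * Real.exp (-8)) * (ℓ : ℝ) ^ (-(1 : ℝ) / 2) * (n : ℝ) ^ (-(ℓ : ℝ)) *
                (n : ℝ) ^ (-(Real.exp 1 * c + c * 31 / δ ^ 2)) ≤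
    Real.exp (-1) * ((n:ℝ)⁻¹ * lam * Real.exp (1 - (n:ℝ)⁻¹ * lam)) ^ ℓ *
      (kap 100 ^ K * Real.exp (-(8 * (1 + Real.log ℓ) + 8 * ℓ / (δ * L) ^ 2))) := by
  have hkp := kap_pos 100
  have hL0 : 0 < L := by linarith
  have hL2 : 0 < L ^ 2 := by positivity
  have he3 : Real.exp 1 < 3 := by linarith [Real.exp_one_lt_d9]
  have hx2 : (L ^ 2)⁻¹ ≤ 1 / 100 := by
    rw [inv_le_comm₀ hL2 (by norm_num)]; nlinarith
  -- the one-step factor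
  have hA : Real.exp (-L - 7 * (L ^ 2)⁻¹) ≤ (n:ℝ)⁻¹ * lam * Real.exp (1 - (n:ℝ)⁻¹ * lam) := by
    have h1 : (n:ℝ)⁻¹ = Real.exp (-L) := by rw [hn, Real.exp_neg]
    have h2 : Real.exp (-1 - 6 * (L ^ 2)⁻¹) ≤ lam := by
      have h3 := exp_le_one_sub (x := Real.exp 1 * (L ^ 2)⁻¹) (by positivity) (by
        nlinarith [inv_pos.2 hL2])
      have h4 : lam = Real.exp (-1) * (1 - Real.exp 1 * (L ^ 2)⁻¹) := by
        rw [hlam, mul_sub, mul_one, ← mul_assoc, ← Real.exp_add]; simp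
      rw [h4, sub_eq_add_neg, Real.exp_add]
      refine mul_le_mul_of_nonneg_left (le_trans (Real.exp_le_exp.2 ?_) h3) (Real.exp_pos _).le
      nlinarith [inv_pos.2 hL2]
    have h5 : (n:ℝ)⁻¹ * lam ≤ (L ^ 2)⁻¹ := by
      have hq := Real.quadratic_le_exp_of_nonneg hL0.le
      have : (n:ℝ)⁻¹ ≤ 2 * (L ^ 2)⁻¹ := by
        rw [hn, inv_le_comm₀ (Real.exp_pos _) (by positivity), mul_inv, inv_inv]
        linarith
      have h0 : 0 < (L ^ 2)⁻¹ := by positivity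
      nlinarith
    have e : Real.exp (-L - 7 * (L ^ 2)⁻¹) =
        Real.exp (-L) * Real.exp (-1 - 6 * (L ^ 2)⁻¹) * Real.exp (1 - (L ^ 2)⁻¹) := by
      rw [← Real.exp_add, ← Real.exp_add]; congr 1; ring
    rw [e, ← h1]
    have : 0 < (n:ℝ)⁻¹ := by rw [h1]; exact Real.exp_pos _
    gcongr
  have hAl : Real.exp (ℓ * (-L - 7 * (L ^ 2)⁻¹)) ≤
      ((n:ℝ)⁻¹ * lam * Real.exp (1 - (n:ℝ)⁻¹ * lam)) ^ ℓ := by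
    rw [Real.exp_nat_mul]
    exact pow_le_pow_left₀ (Real.exp_pos _).le hA ℓ
  have hpow : ∀ x : ℝ, (n:ℝ) ^ x = Real.exp (L * x) := by
    intro x
    rw [hn, ← Real.exp_mul]
  have hhalf : (ℓ : ℝ) ^ (-(1 : ℝ) / 2) ≤ 1 :=
    Real.rpow_le_one_of_one_le_of_nonpos hℓ1 (by norm_num)
  rw [hpow, hpow]
  have hcL : 0 < c * L := by positivity
  have hd : 1 ≤ (δ ^ 2)⁻¹ := by
    rw [one_le_inv₀ (by positivity)]; nlinarith
  have hr1 : ℓ * (7 * (L ^ 2)⁻¹) ≤ 14 * (c * L) := by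
    calc ℓ * (7 * (L ^ 2)⁻¹) ≤ (2 * c * L ^ 3) * (7 * (L ^ 2)⁻¹) := by gcongr
      _ = 14 * (c * L) := by field_simp; ring
  have hr2 : 8 * ℓ / (δ * L) ^ 2 ≤ 16 * (c * L) * (δ ^ 2)⁻¹ := by
    calc 8 * ℓ / (δ * L) ^ 2 ≤ 8 * (2 * c * L ^ 3) / (δ * L) ^ 2 := by gcongr
      _ = 16 * (c * L) * (δ ^ 2)⁻¹ := by field_simp; ring
  have hmain : Real.exp (-8) * (Real.exp (L * -(ℓ:ℝ)) *
      Real.exp (L * -(Real.exp 1 * c + c * 31 / δ ^ 2))) ≤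
      Real.exp (ℓ * (-L - 7 * (L ^ 2)⁻¹)) *
        Real.exp (-(8 * (1 + Real.log ℓ) + 8 * ℓ / (δ * L) ^ 2)) := by
    rw [← Real.exp_add, ← Real.exp_add, ← Real.exp_add]
    apply Real.exp_le_exp.2
    have e1 : L * -(Real.exp 1 * c + c * 31 / δ ^ 2) =
      -(Real.exp 1 * (c * L)) - 31 * (c * L) * (δ ^ 2)⁻¹ := by ring
    rw [e1]
    have e2 : 15 * (c * L) ≤ 15 * (c * L) * (δ ^ 2)⁻¹ := by nlinarith
    have e3 : 0 < Real.exp 1 * (c * L) := by positivity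
    linarith
  calc _ = (Real.exp (-1) * kap 100 ^ K) * ((ℓ : ℝ) ^ (-(1 : ℝ) / 2) *
        (Real.exp (-8) * (Real.exp (L * -(ℓ:ℝ)) *
      Real.exp (L * -(Real.exp 1 * c + c * 31 / δ ^ 2))))) := by ring
    _ ≤ (Real.exp (-1) * kap 100 ^ K) * (1 * (Real.exp (ℓ * (-L - 7 * (L ^ 2)⁻¹)) *
        Real.exp (-(8 * (1 + Real.log ℓ) + 8 * ℓ / (δ * L) ^ 2)))) := by gcongr
    _ ≤ (Real.exp (-1) * kap 100 ^ K) * (1 *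
        (((n:ℝ)⁻¹ * lam * Real.exp (1 - (n:ℝ)⁻¹ * lam)) ^ ℓ *
        Real.exp (-(8 * (1 + Real.log ℓ) + 8 * ℓ / (δ * L) ^ 2)))) := by gcongr
    _ = _ := by ring

lemma incl {n ℓ : ℕ} (γ : Path n ℓ) (lam D : ℝ) (hl0 : 0 < lam) (hl1 : lam ≤ 1 / 2)
    (hD : 1 ≤ D) (ω : Sym2 (Fin n) → ℝ) (h : (fun i => ω (γ.edge i)) ∈ Ev lam (lam * D) ℓ 0) :
    lam * ℓ - 1 ≤ weight ω γ ∧ weight ω γ ≤ lam * ℓ ∧ deviation ω γ ≤ D := by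
  obtain ⟨⟨h1, h2⟩, h3⟩ := Ev_spec lam (lam * D) ℓ 0 _ (by nlinarith) hl0.le h
  simp only [zero_add] at h1 h2 h3
  have hw : ∑ i, ω (γ.edge i) = weight ω γ := rfl
  rw [hw] at h1 h2
  refine ⟨by linarith, by linarith, ?_⟩
  unfold deviation
  apply Real.iSup_le _ (by linarith)
  intro k
  have hk := h3 (k + 1) k.2
  have hp : (∑ i : Fin ℓ, if (i : ℕ) < (k : ℕ) + 1 then ω (γ.edge i) else 0) =
    partialSum ω γ (k + 1) := rfl
  rw [hp] at hk
  push_cast at hk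
  have hℓ : (0:ℝ) < ℓ := by exact_mod_cast (Nat.zero_le _).trans_lt k.2
  have hkl : ((k:ℕ) + 1 : ℝ) ≤ ℓ := by exact_mod_cast k.2
  have hq0 : 0 ≤ ((k:ℕ) + 1 : ℝ) / ℓ := by positivity
  have hq1 : ((k:ℕ) + 1 : ℝ) / ℓ ≤ 1 := by rw [div_le_one hℓ]; exact hkl
  have e : partialSum ω γ ((k : ℕ) + 1) - (((k : ℕ) + 1 : ℝ) / ℓ) * weight ω γ =
    (partialSum ω γ ((k : ℕ) + 1) - ((k:ℕ) + 1) * lam)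
      - (((k : ℕ) + 1 : ℝ) / ℓ) * (weight ω γ - ℓ * lam) := by
    field_simp; ring
  rw [e]
  refine (abs_sub _ _).trans ?_
  have hb : |(((k : ℕ) + 1 : ℝ) / ℓ) * (weight ω γ - ℓ * lam)| ≤ lam := by
    rw [abs_mul, abs_of_nonneg hq0]
    have : |weight ω γ - ℓ * lam| ≤ lam := abs_le.2 ⟨by linarith, by linarith⟩
    calc _ ≤ 1 * lam := by gcongr
      _ = lam := one_mul _
  nlinarith

lemma large (δ c : ℝ) (hδ : 0 < δ) (hc : 0 < c) :
    ∃ n₀ : ℕ, ∀ n : ℕ, n₀ ≤ n → 1 ≤ n ∧ 10 ≤ Real.log n ∧ 100 ≤ δ * Real.log n ∧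
      400 ≤ c * Real.log n ^ 3 ∧ 8 * Real.log (2 * c * Real.log n ^ 3) ≤ c * Real.log n := by
  have ht : Tendsto (fun n : ℕ => Real.log n) atTop atTop :=
    Real.tendsto_log_atTop.comp tendsto_natCast_atTop_atTop
  have h1 : ∀ᶠ x : ℝ in atTop, 10 ≤ x ∧ 100 ≤ δ * x ∧ 400 ≤ c * x ^ 3 ∧
      8 * Real.log (2 * c * x ^ 3) ≤ c * x := by
    have hlo := Real.isLittleO_log_id_atTop.bound (show (0:ℝ) < c / 48 by positivity)
    filter_upwards [hlo, eventually_ge_atTop (10:ℝ), eventually_ge_atTop (100 / δ),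
      eventually_ge_atTop (400 / c), eventually_ge_atTop (16 * Real.log (2 * c) / c)]
      with x hx h10 hd h4 h5
    have hx0 : 0 < x := by linarith
    rw [div_le_iff₀ hc] at h4 h5
    rw [div_le_iff₀ hδ] at hd
    refine ⟨h10, by linarith, ?_, ?_⟩
    · have : x ≤ x ^ 3 := by nlinarith [sq_nonneg x]
      nlinarith
    · rw [Real.log_mul (by positivity) (by positivity), Real.log_pow]
      simp only [id, Real.norm_eq_abs, abs_of_pos hx0] at hx
      have := le_abs_self (Real.log x)
      push_cast
      linarith
  obtain ⟨n₀, h⟩ := eventually_atTop.1 ((ht.eventually h1).and (eventually_ge_atTop 1))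
  exact ⟨n₀, fun n hn => ⟨(h n hn).2, (h n hn).1⟩⟩

/-- The first-moment lower bound (2.9): there is an absolute constant C⁺ > 0 such that for
every δ ∈ (0,1] and c ∈ (0,1] there is c₀ > 0 so that, for large n, with
λ = e⁻¹ - (log n)⁻² and ℓ = ⌈c (log n)³⌉, every path γ of length ℓ satisfies
P(λℓ - 1 ≤ X(γ) ≤ λℓ, M(γ) ≤ δ log n) ≥ c₀ ℓ^{-1/2} n^{-ℓ} n^{-ec - cC⁺/δ²}. -/
theorem first_moment_lower :
    ∃ Cp : ℝ, 0 < Cp ∧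
      ∀ δ c : ℝ, 0 < δ → δ ≤ 1 → 0 < c → c ≤ 1 →
        ∃ c₀ : ℝ, 0 < c₀ ∧ ∃ n₀ : ℕ, ∀ n : ℕ, n₀ ≤ n →
          ∀ ℓ : ℕ, ℓ = ⌈c * (Real.log n) ^ 3⌉₊ →
          ∀ lam : ℝ, lam = Real.exp (-1) - ((Real.log n) ^ 2)⁻¹ →
          ∀ γ : Path n ℓ,
            c₀ * (ℓ : ℝ) ^ (-(1 : ℝ) / 2) * (n : ℝ) ^ (-(ℓ : ℝ)) *
                (n : ℝ) ^ (-(Real.exp 1 * c + c * Cp / δ ^ 2)) ≤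
              (P n {ω | lam * ℓ - 1 ≤ weight ω γ ∧ weight ω γ ≤ lam * ℓ ∧
                        deviation ω γ ≤ δ * Real.log n}).toReal := by
  refine ⟨31, by norm_num, ?_⟩
  intro δ c hδ hδ1 hc hc1
  obtain ⟨K, hK⟩ : ∃ K : ℕ, K = 400 := ⟨_, rfl⟩
  have hkp := kap_pos 100
  refine ⟨Real.exp (-1) * kap 100 ^ K * Real.exp (-8), by positivity, ?_⟩
  obtain ⟨n₀, hn₀⟩ := large δ c hδ hc
  refine ⟨n₀, fun n hn ℓ hℓ lam hlam γ => ?_⟩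
  obtain ⟨hn1, hL10, hDL, hcL, hlog⟩ := hn₀ n hn
  have hnpos : (0:ℝ) < n := by exact_mod_cast hn1
  have hnexp : (n:ℝ) = Real.exp (Real.log n) := (Real.exp_log hnpos).symm
  have hge : c * Real.log n ^ 3 ≤ ℓ := by rw [hℓ]; exact Nat.le_ceil _
  have hlt : (ℓ:ℝ) < c * Real.log n ^ 3 + 1 := by
    rw [hℓ]; exact Nat.ceil_lt_add_one (by linarith)
  have hle : (ℓ:ℝ) ≤ 2 * c * Real.log n ^ 3 := by linarith
  have hℓ1 : (1:ℝ) ≤ ℓ := by linarith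
  have hKℓ : K ≤ ℓ := by
    have : (K:ℝ) ≤ ℓ := by rw [hK]; push_cast; linarith
    exact_mod_cast this
  have hlogℓ : 8 * Real.log ℓ ≤ c * Real.log n := by
    refine le_trans ?_ hlog
    have := Real.log_le_log (by linarith) hle
    linarith
  have hx2 : ((Real.log n) ^ 2)⁻¹ ≤ 1 / 100 := by
    rw [inv_le_comm₀ (by positivity) (by norm_num)]; nlinarith
  have hx0 : 0 < ((Real.log n) ^ 2)⁻¹ := by positivity
  have hem := Real.exp_neg_one_gt_d9
  have hem2 := Real.exp_neg_one_lt_d9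
  have hl0 : 0 < lam := by rw [hlam]; linarith
  have hl1 : lam ≤ 1 / 2 := by rw [hlam]; linarith
  have hr : (0:ℝ) < (n:ℝ)⁻¹ := by positivity
  have hprob : IsProbabilityMeasure (expMeasure (n:ℝ)⁻¹) := isProbabilityMeasure_expMeasure hr
  have hcore := core_s18 (n:ℝ)⁻¹ lam (δ * Real.log n) hr hl0 hDL K hK ℓ hKℓ
  have hnum := numeric δ c (Real.log n) n ℓ K hδ hδ1 hc hnexp hL10 hle hℓ1 hlogℓ lam hlam hl0 hl1
  have hlaw := law_path (n:ℝ)⁻¹ hr γ.edge (edge_inj γ.1 γ.2)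
  have hEm : MeasurableSet (Ev lam (lam * (δ * Real.log n)) ℓ 0) := by
    have hm : Measurable fun y : Fin ℓ → ℝ => ((0:ℝ), y) := by fun_prop
    exact hm (Ev_meas lam (lam * (δ * Real.log n)) ℓ)
  rw [← hlaw.measure_preimage hEm.nullMeasurableSet] at hcore
  have hfin : P n {ω | lam * ℓ - 1 ≤ weight ω γ ∧ weight ω γ ≤ lam * ℓ ∧
                        deviation ω γ ≤ δ * Real.log n} ≠ ⊤ := by
    unfold P; exact measure_ne_top _ _
  refine hnum.trans ((ENNReal.ofReal_le_iff_le_toReal hfin).1 (hcore.trans ?_))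
  unfold P
  apply measure_mono
  intro ω hω
  exact incl γ lam (δ * Real.log n) hl0 hl1 (by linarith) ω hω

end Paper
end
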